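/- Let N ≥ 2, q > 1, q' = q/(q−1), R > 0, and let K ⊂ ℝ^{N+1} be compact. Then there exist a constant C = C(N,q,R) ≥ 1 and a nonnegative Radon measure μ on ℝ^{N+1} with compact support contained in K such that C^{−1} Cap_{2,1,q'}(K) ≤ μ(K) ≤ C Cap_{2,1,q'}(K) and C^{−1} Cap_{2,1,q'}(K) ≤ ∫_{ℝ^{N+1}} ( I_2^{2R}[μ](x,t) )^q dx dt ≤ C Cap_{2,1,q'}(K). -/

import Mathlib

open MeasureTheory Metric Set
open scoped ENNReal NNReal

noncomputable section

/-- Points of `ℝ^{N+1}` are written `(x, t)` with `x ∈ ℝ^N` and `t ∈ ℝ`. -/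
abbrev PSpace (N : ℕ) := EuclideanSpace ℝ (Fin N) × ℝ

/-- The parabolic cylinder `Q_δ(x,t) = B_δ(x) × (t - δ², t]`. -/
def pQ (N : ℕ) (δ : ℝ) (z : PSpace N) : Set (PSpace N) :=
  ball z.1 δ ×ˢ Ioc (z.2 - δ ^ 2) z.2

/-- The parabolic cylinder `Q̃_r(x,t) = B_r(x) × (t - r², t + r²)`. -/
def pQt (N : ℕ) (r : ℝ) (z : PSpace N) : Set (PSpace N) :=
  ball z.1 r ×ˢ Ioo (z.2 - r ^ 2) (z.2 + r ^ 2)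

/-- The parabolic boundary of an open set `O ⊆ ℝ^{N+1}`: points of the topological
boundary such that every downward cylinder `Q_δ` meets the complement of `O`. -/
def pBoundary (N : ℕ) (O : Set (PSpace N)) : Set (PSpace N) :=
  {z ∈ frontier O | ∀ δ > 0, (pQ N δ z ∩ Oᶜ).Nonempty}

/-- Partial derivative in time. -/
def tDeriv {N : ℕ} (u : PSpace N → ℝ) (z : PSpace N) : ℝ :=
  deriv (fun s => u (z.1, s)) z.2

/-- Partial derivative in the `i`-th spatial direction. -/
def xDeriv {N : ℕ} (i : Fin N) (u : PSpace N → ℝ) (z : PSpace N) : ℝ :=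
  lineDeriv ℝ (fun y => u (y, z.2)) z.1 (EuclideanSpace.single i 1)

/-- Second spatial partial derivative. -/
def xxDeriv {N : ℕ} (i j : Fin N) (u : PSpace N → ℝ) (z : PSpace N) : ℝ :=
  xDeriv i (xDeriv j u) z

/-- Spatial Laplacian. -/
def lapl {N : ℕ} (u : PSpace N → ℝ) (z : PSpace N) : ℝ :=
  ∑ i : Fin N, xxDeriv i i u z

/-- Euclidean norm of the spatial gradient. -/
def gradNorm {N : ℕ} (u : PSpace N → ℝ) (z : PSpace N) : ℝ :=
  Real.sqrt (∑ i : Fin N, (xDeriv i u z) ^ 2)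

/-- `u ∈ C^{2,1}(O)` : `u`, its first and second spatial derivatives and its time
derivative exist and are continuous in `O`. -/
structure IsC21 {N : ℕ} (O : Set (PSpace N)) (u : PSpace N → ℝ) : Prop where
  cont : ContinuousOn u O
  diff_t : ∀ z ∈ O, DifferentiableAt ℝ (fun s => u (z.1, s)) z.2
  cont_t : ContinuousOn (tDeriv u) O
  diff_x : ∀ (i : Fin N), ∀ z ∈ O,
    LineDifferentiableAt ℝ (fun y => u (y, z.2)) z.1 (EuclideanSpace.single i 1)
  cont_x : ∀ i : Fin N, ContinuousOn (xDeriv i u) O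
  diff_xx : ∀ (i j : Fin N), ∀ z ∈ O,
    LineDifferentiableAt ℝ (fun y => xDeriv j u (y, z.2)) z.1 (EuclideanSpace.single i 1)
  cont_xx : ∀ i j : Fin N, ContinuousOn (xxDeriv i j u) O

/-- The blow-up condition `lim_{δ→0} inf_{O ∩ Q_δ(z)} u = ∞` at every point of the
parabolic boundary. -/
def BlowsUp {N : ℕ} (O : Set (PSpace N)) (u : PSpace N → ℝ) : Prop :=
  ∀ z ∈ pBoundary N O, ∀ M : ℝ, ∃ δ > (0 : ℝ), ∀ w ∈ O ∩ pQ N δ z, M ≤ u w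

/-- A large solution of `∂_t u - Δu + f(u) = 0` in `O`. -/
def IsLargeSolution {N : ℕ} (O : Set (PSpace N)) (f : ℝ → ℝ) (u : PSpace N → ℝ) : Prop :=
  IsC21 O u ∧ (∀ z ∈ O, tDeriv u z - lapl u z + f (u z) = 0) ∧ BlowsUp O u

/-- The parabolic Sobolev norm `‖φ‖_{W^{2,1}_p(ℝ^{N+1})}`. -/
def W21Norm (N : ℕ) (p : ℝ) (φ : PSpace N → ℝ) : ℝ :=
  (eLpNorm φ (ENNReal.ofReal p) volume).toReal
    + (eLpNorm (tDeriv φ) (ENNReal.ofReal p) volume).toReal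
    + (eLpNorm (gradNorm φ) (ENNReal.ofReal p) volume).toReal
    + ∑ i : Fin N, ∑ j : Fin N, (eLpNorm (xxDeriv i j φ) (ENNReal.ofReal p) volume).toReal

/-- The capacity `Cap_{2,1,p}` of a compact set `K ⊆ ℝ^{N+1}`. -/
def cap21c (N : ℕ) (p : ℝ) (K : Set (PSpace N)) : ℝ :=
  sInf { c | ∃ φ : SchwartzMap (PSpace N) ℝ,
    (∃ U, IsOpen U ∧ K ⊆ U ∧ ∀ z ∈ U, 1 ≤ φ z) ∧ c = W21Norm N p (fun z => φ z) ^ p }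

/-- The capacity `Cap_{2,1,p}` of an arbitrary (Suslin) set. -/
def cap21 (N : ℕ) (p : ℝ) (E : Set (PSpace N)) : ℝ :=
  sSup { c | ∃ D, D ⊆ E ∧ IsCompact D ∧ c = cap21c N p D }

/-- The parabolic Hausdorff capacity `PH_ρ^N(E)`. -/
def PHcap (N : ℕ) (ρ : ℝ) (E : Set (PSpace N)) : ℝ≥0∞ :=
  ⨅ (c : ℕ → PSpace N × ℝ)
    (_ : (∀ j, 0 ≤ (c j).2 ∧ (c j).2 ≤ ρ) ∧ E ⊆ ⋃ j, pQt N (c j).2 (c j).1),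
    ∑' j, ENNReal.ofReal ((c j).2 ^ N)

/-- The truncated Riesz parabolic potential `I_2^R[μ]`. -/
def riesz (N : ℕ) (R : ℝ) (μ : Measure (PSpace N)) (z : PSpace N) : ℝ≥0∞ :=
  ∫⁻ ρ in Ioo (0 : ℝ) R, μ (pQt N ρ z) / ENNReal.ofReal (ρ ^ (N + 1))

/-- The truncated fractional maximal parabolic potential `M_2^R[μ]`. -/
def maxPot (N : ℕ) (R : ℝ) (μ : Measure (PSpace N)) (z : PSpace N) : ℝ≥0∞ :=
  ⨆ (ρ : ℝ) (_ : ρ ∈ Ioo (0 : ℝ) R), μ (pQt N ρ z) / ENNReal.ofReal (ρ ^ N)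

/-- The Gaussian heat kernel on `ℝ^{N+1}`. -/
def heatK (N : ℕ) (z : PSpace N) : ℝ :=
  if 0 < z.2 then (4 * Real.pi * z.2) ^ (-(N : ℝ) / 2) * Real.exp (-‖z.1‖ ^ 2 / (4 * z.2))
  else 0

/-- The heat potential `(ℍ * μ)(x,t)` of a nonnegative measure. -/
def heatPot (N : ℕ) (μ : Measure (PSpace N)) (z : PSpace N) : ℝ≥0∞ :=
  ∫⁻ w, ENNReal.ofReal (heatK N (z.1 - w.1, z.2 - w.2)) ∂μ

/-- Exponential on `ℝ≥0∞`. -/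
def expE (x : ℝ≥0∞) : ℝ≥0∞ := if x = ⊤ then ⊤ else ENNReal.ofReal (Real.exp x.toReal)

/-- Parabolic distance from a point to a set (taken over points at earlier times). -/
def pDist (N : ℕ) (z : PSpace N) (S : Set (PSpace N)) : ℝ :=
  sInf { r | ∃ w ∈ S, w.2 ≤ z.2 ∧ r = max (dist z.1 w.1) (Real.sqrt (z.2 - w.2)) }

end

section CapacitaryMeasure

open scoped ContDiff

theorem mem_pQt {N : ℕ} {r : ℝ} {z w : PSpace N} :
    w ∈ pQt N r z ↔ dist w.1 z.1 < r ∧ |w.2 - z.2| < r ^ 2 := by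
  simp only [pQt, mem_prod, mem_ball, mem_Ioo, abs_lt]
  constructor <;> rintro ⟨h, h1, h2⟩ <;> exact ⟨h, by linarith, by linarith⟩

theorem mem_pQt_comm {N : ℕ} {r : ℝ} {z w : PSpace N} : w ∈ pQt N r z ↔ z ∈ pQt N r w := by
  rw [mem_pQt, mem_pQt, dist_comm, abs_sub_comm]

theorem mem_pQt_trans {N : ℕ} {a b : ℝ} (ha : 0 ≤ a) (hb : 0 ≤ b) {z w v : PSpace N}
    (h : w ∈ pQt N a z) (h' : v ∈ pQt N b w) : v ∈ pQt N (a + b) z := by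
  rw [mem_pQt] at *
  refine ⟨?_, ?_⟩
  · linarith [dist_triangle v.1 w.1 z.1, h.1, h'.1]
  · have : |v.2 - z.2| ≤ |v.2 - w.2| + |w.2 - z.2| := by
      simpa using abs_add_le (v.2 - w.2) (w.2 - z.2)
    nlinarith [h.2, h'.2, mul_nonneg ha hb]

theorem pQt_mono {N : ℕ} {a b : ℝ} (ha : 0 ≤ a) (hab : a ≤ b) (z : PSpace N) :
    pQt N a z ⊆ pQt N b z := by
  intro w hw
  rw [mem_pQt] at *
  exact ⟨hw.1.trans_le hab, hw.2.trans_le (by gcongr)⟩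

theorem isOpen_pQt (N : ℕ) (r : ℝ) (z : PSpace N) : IsOpen (pQt N r z) :=
  isOpen_ball.prod isOpen_Ioo

theorem measurableSet_pQt (N : ℕ) (r : ℝ) (z : PSpace N) : MeasurableSet (pQt N r z) :=
  (isOpen_pQt N r z).measurableSet

theorem isOpen_setOf_mem_pQt (N : ℕ) :
    IsOpen {x : ℝ × PSpace N × PSpace N | x.2.2 ∈ pQt N x.1 x.2.1} := by
  simp only [mem_pQt, ofPred_and]
  exact (isOpen_lt (by fun_prop) (by fun_prop)).inter (isOpen_lt (by fun_prop) (by fun_prop))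

theorem measurable_measure_pQt_uncurry {N : ℕ} (μ : Measure (PSpace N)) [SFinite μ] :
    Measurable (fun x : ℝ × PSpace N => μ (pQt N x.1 x.2)) := by
  have h : MeasurableSet {y : (ℝ × PSpace N) × PSpace N | y.2 ∈ pQt N y.1.1 y.1.2} :=
    ((isOpen_setOf_mem_pQt N).preimage (f := fun y : (ℝ × PSpace N) × PSpace N =>
      (y.1.1, y.1.2, y.2)) (by fun_prop)).measurableSet
  have h' := measurable_measure_prodMk_left (ν := μ) h
  have e (x : ℝ × PSpace N) : pQt N x.1 x.2 =
      Prod.mk x ⁻¹' {y : (ℝ × PSpace N) × PSpace N | y.2 ∈ pQt N y.1.1 y.1.2} := by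
    ext; simp
  rw [show (fun x : ℝ × PSpace N => μ (pQt N x.1 x.2)) = fun x => μ (Prod.mk x ⁻¹'
    {y : (ℝ × PSpace N) × PSpace N | y.2 ∈ pQt N y.1.1 y.1.2}) from funext fun x => by rw [e x]]
  exact h'

theorem measurable_measure_pQt {N : ℕ} (r : ℝ) (μ : Measure (PSpace N)) [SFinite μ] :
    Measurable (fun z : PSpace N => μ (pQt N r z)) := by
  have h : Measurable (fun z : PSpace N => ((r, z) : ℝ × PSpace N)) := by fun_prop
  have h' := (measurable_measure_pQt_uncurry μ).comp h
  simpa only [Function.comp_def] using h'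

/-- The Lebesgue measure of the parabolic cylinder of radius one. -/
noncomputable def pVol (N : ℕ) : ℝ≥0∞ := volume (pQt N 1 0)

theorem pVol_ne_zero (N : ℕ) : pVol N ≠ 0 := by
  refine ((isOpen_pQt N 1 0).measure_pos volume ⟨0, ?_⟩).ne'
  simp [mem_pQt]

theorem pVol_ne_top (N : ℕ) : pVol N ≠ ⊤ := by
  have h : Bornology.IsBounded (pQt N 1 0) := isBounded_ball.prod (isBounded_Ioo _ _)
  exact h.measure_lt_top.ne

theorem volume_pQt {N : ℕ} {r : ℝ} (hr : 0 < r) (z : PSpace N) :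
    volume (pQt N r z) = ENNReal.ofReal (r ^ (N + 2)) * pVol N := by
  have h (s : ℝ) (hs : 0 < s) (x : PSpace N) : volume (pQt N s x) =
      ENNReal.ofReal (s ^ N) * volume (ball (0 : EuclideanSpace ℝ (Fin N)) 1) *
        ENNReal.ofReal (2 * s ^ 2) := by
    rw [pQt, Measure.volume_eq_prod, Measure.prod_prod, Measure.addHaar_ball_of_pos _ _ hs,
      Real.volume_Ioo, finrank_euclideanSpace_fin]
    ring_nf
  rw [pVol, h r hr, h 1 one_pos]
  have h2 : ENNReal.ofReal (r ^ (N + 2)) = ENNReal.ofReal (r ^ N) * ENNReal.ofReal (r ^ 2) := by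
    rw [← ENNReal.ofReal_mul (by positivity), pow_add]
  have h3 : ENNReal.ofReal (2 * r ^ 2) = ENNReal.ofReal 2 * ENNReal.ofReal (r ^ 2) :=
    ENNReal.ofReal_mul (by norm_num)
  rw [h2, h3]
  simp only [one_pow, ENNReal.ofReal_one, mul_one, one_mul]
  ring

theorem volume_pQt_ne_zero {N : ℕ} {r : ℝ} (hr : 0 < r) (z : PSpace N) :
    volume (pQt N r z) ≠ 0 := by
  rw [volume_pQt hr]
  exact mul_ne_zero (by simpa using pow_pos hr _) (pVol_ne_zero N)

theorem volume_pQt_ne_top {N : ℕ} {r : ℝ} (hr : 0 < r) (z : PSpace N) :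
    volume (pQt N r z) ≠ ⊤ := by
  rw [volume_pQt hr]
  exact ENNReal.mul_ne_top (by simp) (pVol_ne_top N)

theorem volume_pQt_eq {N : ℕ} {r : ℝ} (hr : 0 < r) (z z' : PSpace N) :
    volume (pQt N r z) = volume (pQt N r z') := by
  rw [volume_pQt hr, volume_pQt hr]

/-- Tonelli for functions integrated against the incidence relation of parabolic cylinders. -/
theorem lintegral_lintegral_pQt_swap {N : ℕ} (r : ℝ) (μ ν : Measure (PSpace N)) [SFinite μ]
    [SFinite ν] {f g : PSpace N → ℝ≥0∞} (hf : Measurable f) (hg : Measurable g) :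
    ∫⁻ z, g z * ∫⁻ w in pQt N r z, f w ∂μ ∂ν = ∫⁻ w, f w * ∫⁻ z in pQt N r w, g z ∂ν ∂μ := by
  have hS : MeasurableSet {y : PSpace N × PSpace N | y.2 ∈ pQt N r y.1} :=
    ((isOpen_setOf_mem_pQt N).preimage (f := fun y : PSpace N × PSpace N =>
      (r, y.1, y.2)) (by fun_prop)).measurableSet
  let F : PSpace N → PSpace N → ℝ≥0∞ := fun z w =>
    {y : PSpace N × PSpace N | y.2 ∈ pQt N r y.1}.indicator (fun y => g y.1 * f y.2) (z, w)
  have hF : Measurable (Function.uncurry F) :=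
    ((hg.comp measurable_fst).mul (hf.comp measurable_snd)).indicator hS
  have h1 (z : PSpace N) : g z * ∫⁻ w in pQt N r z, f w ∂μ = ∫⁻ w, F z w ∂μ := by
    rw [← lintegral_const_mul _ hf, ← lintegral_indicator (measurableSet_pQt N r z)]
    rfl
  have h2 (w : PSpace N) : f w * ∫⁻ z in pQt N r w, g z ∂ν = ∫⁻ z, F z w ∂ν := by
    rw [← lintegral_const_mul _ hg, ← lintegral_indicator (measurableSet_pQt N r w)]
    refine lintegral_congr fun z => ?_
    by_cases hz : z ∈ pQt N r w
    · have hz' : (z, w) ∈ {y : PSpace N × PSpace N | y.2 ∈ pQt N r y.1} := mem_pQt_comm.1 hz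
      simp only [F, indicator_of_mem hz, indicator_of_mem hz', mul_comm]
    · have hz' : (z, w) ∉ {y : PSpace N × PSpace N | y.2 ∈ pQt N r y.1} :=
        fun h => hz (mem_pQt_comm.1 h)
      simp only [F, indicator_of_notMem hz, indicator_of_notMem hz']
  simp_rw [h1, h2]
  exact lintegral_lintegral_swap hF.aemeasurable

theorem lintegral_lintegral_pQt {N : ℕ} {r : ℝ} (hr : 0 < r) {f : PSpace N → ℝ≥0∞}
    (hf : Measurable f) :
    ∫⁻ z, ∫⁻ w in pQt N r z, f w = volume (pQt N r 0) * ∫⁻ w, f w := by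
  have h := lintegral_lintegral_pQt_swap r volume volume hf (measurable_const (a := (1 : ℝ≥0∞)))
  simp only [one_mul, lintegral_const, Measure.restrict_apply, MeasurableSet.univ, univ_inter] at h
  rw [h, ← lintegral_const_mul _ hf]
  refine lintegral_congr fun z => ?_
  rw [mul_comm, volume_pQt_eq hr]

theorem setLIntegral_measure_pQt {N : ℕ} (r : ℝ) (μ : Measure (PSpace N)) [SFinite μ]
    {S : Set (PSpace N)} (hS : MeasurableSet S) :
    ∫⁻ w in S, μ (pQt N r w) = ∫⁻ v, volume (S ∩ pQt N r v) ∂μ := by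
  have h := lintegral_lintegral_pQt_swap r μ volume (measurable_const (a := (1 : ℝ≥0∞)))
    ((measurable_const (a := (1 : ℝ≥0∞))).indicator hS)
  simp only [one_mul, lintegral_const, Measure.restrict_apply, MeasurableSet.univ, univ_inter] at h
  rw [← lintegral_indicator hS]
  calc _ = _ := lintegral_congr fun z => by by_cases hz : z ∈ S <;> simp [hz]
    _ = _ := h
    _ = _ := lintegral_congr fun v => by
      rw [lintegral_indicator hS]
      simp [Measure.restrict_apply, Measure.restrict_restrict hS]

theorem setLIntegral_measure_pQt_le {N : ℕ} {a b : ℝ} (ha : 0 < a) (hb : 0 < b)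
    (μ : Measure (PSpace N)) [SFinite μ] (y : PSpace N) :
    ∫⁻ w in pQt N a y, μ (pQt N b w) ≤ volume (pQt N b 0) * μ (pQt N (a + b) y) := by
  rw [setLIntegral_measure_pQt b μ (measurableSet_pQt N a y)]
  calc ∫⁻ v, volume (pQt N a y ∩ pQt N b v) ∂μ
      ≤ ∫⁻ v, (pQt N (a + b) y).indicator (fun _ => volume (pQt N b 0)) v ∂μ := by
        refine lintegral_mono fun v => ?_
        by_cases hv : v ∈ pQt N (a + b) y
        · rw [indicator_of_mem hv, volume_pQt_eq hb 0 v]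
          exact measure_mono inter_subset_right
        · rw [indicator_of_notMem hv]
          have : pQt N a y ∩ pQt N b v = ∅ := by
            ext w
            simp only [mem_inter_iff, mem_empty_iff_false, iff_false, not_and]
            intro h h'
            exact hv (mem_pQt_trans ha.le hb.le h (mem_pQt_comm.1 h'))
          simp [this]
    _ = _ := by
        rw [lintegral_indicator (measurableSet_pQt _ _ _)]
        simp

theorem le_setLIntegral_measure_pQt {N : ℕ} {a b : ℝ} (ha : 0 < a) (hb : 0 < b)
    (μ : Measure (PSpace N)) [SFinite μ] (y : PSpace N) :
    volume (pQt N b 0) * μ (pQt N a y) ≤ ∫⁻ w in pQt N (a + b) y, μ (pQt N b w) := by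
  rw [setLIntegral_measure_pQt b μ (measurableSet_pQt N _ y)]
  calc volume (pQt N b 0) * μ (pQt N a y)
      = ∫⁻ v, (pQt N a y).indicator (fun _ => volume (pQt N b 0)) v ∂μ := by
        rw [lintegral_indicator (measurableSet_pQt _ _ _)]
        simp
    _ ≤ _ := by
        refine lintegral_mono fun v => ?_
        by_cases hv : v ∈ pQt N a y
        · rw [indicator_of_mem hv, volume_pQt_eq hb 0 v]
          exact measure_mono fun w hw => ⟨mem_pQt_trans ha.le hb.le hv hw, hw⟩
        · rw [indicator_of_notMem hv]
          exact zero_le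

theorem rpow_lintegral_le {α : Type*} [MeasurableSpace α] (ν : Measure α) {p : ℝ} (hp : 1 ≤ p)
    {f : α → ℝ≥0∞} (hf : AEMeasurable f ν) :
    (∫⁻ x, f x ∂ν) ^ p ≤ ν univ ^ (p - 1) * ∫⁻ x, f x ^ p ∂ν := by
  rcases hp.eq_or_lt with rfl | hp
  · simp
  have hpq := Real.HolderConjugate.conjExponent hp
  have h := ENNReal.lintegral_mul_le_Lp_mul_Lq ν hpq hf (aemeasurable_const (b := (1 : ℝ≥0∞)))
  simp only [Pi.mul_apply, mul_one, ENNReal.one_rpow, lintegral_const, one_mul] at h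
  have h0 : 0 < p := by linarith
  calc _ ≤ ((∫⁻ x, f x ^ p ∂ν) ^ (1 / p) * ν univ ^ (1 / p.conjExponent)) ^ p := by gcongr
    _ = _ := by
      rw [ENNReal.mul_rpow_of_nonneg _ _ h0.le, ← ENNReal.rpow_mul, ← ENNReal.rpow_mul,
        one_div_mul_cancel h0.ne', ENNReal.rpow_one, mul_comm]
      congr 2
      rw [Real.conjExponent]; field_simp

theorem lintegral_rpow_le {α : Type*} [MeasurableSpace α] (ν : Measure α) {s : ℝ} (hs : 0 < s)
    (hs1 : s ≤ 1) {f : α → ℝ≥0∞} (hf : AEMeasurable f ν) :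
    ∫⁻ x, f x ^ s ∂ν ≤ ν univ ^ (1 - s) * (∫⁻ x, f x ∂ν) ^ s := by
  have h := rpow_lintegral_le ν ((one_le_inv₀ hs).2 hs1) (hf.pow_const s)
  simp only [← ENNReal.rpow_mul, mul_inv_cancel₀ hs.ne', ENNReal.rpow_one] at h
  calc ∫⁻ x, f x ^ s ∂ν = ((∫⁻ x, f x ^ s ∂ν) ^ s⁻¹) ^ s := by
        rw [← ENNReal.rpow_mul, inv_mul_cancel₀ hs.ne', ENNReal.rpow_one]
    _ ≤ (ν univ ^ (s⁻¹ - 1) * ∫⁻ x, f x ∂ν) ^ s := by gcongr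
    _ = _ := by
        rw [ENNReal.mul_rpow_of_nonneg _ _ hs.le, ← ENNReal.rpow_mul, sub_mul,
          inv_mul_cancel₀ hs.ne', one_mul]

theorem volume_pQt_mul {N : ℕ} {c r : ℝ} (hc : 0 < c) (hr : 0 < r) (z : PSpace N) :
    volume (pQt N (c * r) z) = ENNReal.ofReal (c ^ (N + 2)) * volume (pQt N r z) := by
  rw [volume_pQt (mul_pos hc hr), volume_pQt hr, mul_pow, ENNReal.ofReal_mul (by positivity),
    mul_assoc]

/-- Enlarging the radius of parabolic cylinders changes the `L^q` norm of the measure of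
the cylinder by at most a constant factor. -/
theorem lintegral_measure_pQt_rpow_le {N : ℕ} {q a ρ : ℝ} (hq : 1 ≤ q) (ha : 0 < a) (hρ : 0 < ρ)
    (μ : Measure (PSpace N)) [SFinite μ] :
    ∫⁻ z, μ (pQt N (a * ρ) z) ^ q ≤
      ENNReal.ofReal ((a + 1) ^ (N + 2)) ^ q * ∫⁻ z, μ (pQt N ρ z) ^ q := by
  have hq0 : 0 ≤ q := by linarith
  have haρ : 0 < a * ρ := mul_pos ha hρ
  set V := volume (pQt N ρ 0) with hV
  have hV0 : V ≠ 0 := volume_pQt_ne_zero hρ _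
  have hVt : V ≠ ⊤ := volume_pQt_ne_top hρ _
  have hc : a * ρ + ρ = (a + 1) * ρ := by ring
  set W := volume (pQt N (a * ρ + ρ) 0) with hW
  have hW0 : W ≠ 0 := volume_pQt_ne_zero (by positivity) _
  have hWt : W ≠ ⊤ := volume_pQt_ne_top (by positivity) _
  have hWV : W = ENNReal.ofReal ((a + 1) ^ (N + 2)) * V := by
    rw [hW, hc, volume_pQt_mul (by linarith) hρ]
  have hm : Measurable fun z : PSpace N => μ (pQt N ρ z) ^ q :=
    (measurable_measure_pQt ρ μ).pow_const q
  have h1 (z : PSpace N) : V ^ q * μ (pQt N (a * ρ) z) ^ q ≤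
      W ^ (q - 1) * ∫⁻ w in pQt N (a * ρ + ρ) z, μ (pQt N ρ w) ^ q := by
    rw [← ENNReal.mul_rpow_of_nonneg _ _ hq0]
    calc _ ≤ (∫⁻ w in pQt N (a * ρ + ρ) z, μ (pQt N ρ w)) ^ q := by
          gcongr
          exact le_setLIntegral_measure_pQt haρ hρ μ z
      _ ≤ _ := by
          refine (rpow_lintegral_le _ hq (measurable_measure_pQt ρ μ).aemeasurable).trans ?_
          rw [Measure.restrict_apply_univ, volume_pQt_eq (by positivity) z 0]
  have h2 : V ^ q * ∫⁻ z, μ (pQt N (a * ρ) z) ^ q ≤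
      W ^ q * ∫⁻ z, μ (pQt N ρ z) ^ q := by
    rw [← lintegral_const_mul _ ((measurable_measure_pQt _ μ).pow_const q)]
    refine (lintegral_mono h1).trans ?_
    rw [lintegral_const_mul' _ _ (ENNReal.rpow_ne_top_of_nonneg (by linarith) hWt),
      lintegral_lintegral_pQt (by positivity) hm, ← mul_assoc]
    gcongr
    rw [← hW]
    calc W ^ (q - 1) * W = W ^ (q - 1) * W ^ (1 : ℝ) := by rw [ENNReal.rpow_one]
      _ ≤ W ^ q := by rw [← ENNReal.rpow_add _ _ hW0 hWt, sub_add_cancel]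
  rw [hWV, ENNReal.mul_rpow_of_nonneg _ _ hq0, mul_comm _ (V ^ q), mul_assoc] at h2
  exact (ENNReal.mul_le_mul_iff_right (by simp [hV0, hVt])
    (ENNReal.rpow_ne_top_of_nonneg hq0 hVt)).1 h2

/-- The decay estimate for products of two cylinder functions at different scales. -/
theorem lintegral_measure_pQt_mul_le {N : ℕ} {s e σ ρ : ℝ} (hs : 0 < s) (hs1 : s ≤ 1)
    (he : 0 ≤ e) (hσ : 0 < σ) (hσρ : σ ≤ ρ) (μ : Measure (PSpace N)) [SFinite μ] :
    ∫⁻ z, μ (pQt N σ z) ^ s * μ (pQt N ρ z) ^ e ≤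
      ENNReal.ofReal ((σ / ρ) ^ (N + 2)) ^ s * ∫⁻ z, μ (pQt N (2 * ρ) z) ^ (s + e) := by
  have hρ : 0 < ρ := hσ.trans_le hσρ
  set V := volume (pQt N ρ 0) with hV
  have hV0 : V ≠ 0 := volume_pQt_ne_zero hρ _
  have hVt : V ≠ ⊤ := volume_pQt_ne_top hρ _
  set W := volume (pQt N σ 0) with hW
  have hWt : W ≠ ⊤ := volume_pQt_ne_top hσ _
  have hWV : W = ENNReal.ofReal ((σ / ρ) ^ (N + 2)) * V := by
    rw [hV, ← volume_pQt_mul (by positivity) hρ, div_mul_cancel₀ _ hρ.ne']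
  have h1 (y : PSpace N) : ∫⁻ z in pQt N ρ y, μ (pQt N σ z) ^ s * μ (pQt N ρ z) ^ e ≤
      V ^ (1 - s) * W ^ s * μ (pQt N (2 * ρ) y) ^ (s + e) := by
    calc _ ≤ ∫⁻ z in pQt N ρ y, μ (pQt N σ z) ^ s * μ (pQt N (2 * ρ) y) ^ e := by
          refine setLIntegral_mono' (measurableSet_pQt _ _ _) fun z hz => ?_
          gcongr
          intro w hw
          rw [two_mul]
          exact mem_pQt_trans hρ.le hρ.le hz hw
      _ = (∫⁻ z in pQt N ρ y, μ (pQt N σ z) ^ s) * μ (pQt N (2 * ρ) y) ^ e :=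
          lintegral_mul_const _ ((measurable_measure_pQt σ μ).pow_const s)
      _ ≤ (V ^ (1 - s) * (W * μ (pQt N (2 * ρ) y)) ^ s) * μ (pQt N (2 * ρ) y) ^ e := by
          gcongr
          refine (lintegral_rpow_le _ hs hs1 (measurable_measure_pQt σ μ).aemeasurable).trans ?_
          rw [Measure.restrict_apply_univ, volume_pQt_eq hρ y 0]
          gcongr
          refine (setLIntegral_measure_pQt_le hρ hσ μ y).trans ?_
          gcongr
          exact pQt_mono (by positivity) (by linarith) y
      _ = _ := by
          rw [ENNReal.mul_rpow_of_nonneg _ _ hs.le, ENNReal.rpow_add_of_nonneg _ _ hs.le he]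
          ring
  have hm : Measurable fun z : PSpace N => μ (pQt N σ z) ^ s * μ (pQt N ρ z) ^ e :=
    ((measurable_measure_pQt _ μ).pow_const s).mul ((measurable_measure_pQt _ μ).pow_const e)
  have h2 : V * ∫⁻ z, μ (pQt N σ z) ^ s * μ (pQt N ρ z) ^ e ≤
      V ^ (1 - s) * W ^ s * ∫⁻ z, μ (pQt N (2 * ρ) z) ^ (s + e) := by
    rw [← lintegral_lintegral_pQt hρ hm, ← lintegral_const_mul _
      ((measurable_measure_pQt _ μ).pow_const _)]
    exact lintegral_mono h1
  have h3 : V ^ (1 - s) * W ^ s = V * ENNReal.ofReal ((σ / ρ) ^ (N + 2)) ^ s := by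
    rw [hWV, ENNReal.mul_rpow_of_nonneg _ _ hs.le, mul_comm _ (V ^ s), ← mul_assoc,
      ← ENNReal.rpow_add _ _ hV0 hVt]
    simp
  rw [h3, mul_assoc] at h2
  exact (ENNReal.mul_le_mul_iff_right hV0 hVt).1 h2

/-- The normalized measure `ρ^{-N} μ(Q̃_ρ(z))` of a parabolic cylinder. -/
noncomputable def pDens {N : ℕ} (μ : Measure (PSpace N)) (ρ : ℝ) (z : PSpace N) : ℝ≥0∞ :=
  (ENNReal.ofReal (ρ ^ N))⁻¹ * μ (pQt N ρ z)

theorem measurable_pDens {N : ℕ} (μ : Measure (PSpace N)) [SFinite μ] (ρ : ℝ) :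
    Measurable (pDens μ ρ) :=
  (measurable_measure_pQt ρ μ).const_mul _

theorem pDens_rpow {N : ℕ} (μ : Measure (PSpace N)) (ρ : ℝ) (z : PSpace N) {s : ℝ} (hs : 0 ≤ s) :
    pDens μ ρ z ^ s = (ENNReal.ofReal (ρ ^ N))⁻¹ ^ s * μ (pQt N ρ z) ^ s := by
  rw [pDens, ENNReal.mul_rpow_of_nonneg _ _ hs]

theorem lintegral_pDens_rpow_le {N : ℕ} {q a ρ : ℝ} (hq : 1 ≤ q) (ha : 1 ≤ a) (hρ : 0 < ρ)
    (μ : Measure (PSpace N)) [SFinite μ] :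
    ∫⁻ z, pDens μ (a * ρ) z ^ q ≤
      ENNReal.ofReal ((a + 1) ^ (N + 2)) ^ q * ∫⁻ z, pDens μ ρ z ^ q := by
  have hq0 : 0 ≤ q := by linarith
  simp_rw [pDens_rpow _ _ _ hq0]
  rw [lintegral_const_mul _ ((measurable_measure_pQt _ μ).pow_const _),
    lintegral_const_mul _ ((measurable_measure_pQt _ μ).pow_const _), mul_left_comm]
  gcongr
  · nlinarith
  · exact lintegral_measure_pQt_rpow_le hq (by linarith) hρ μ

theorem lintegral_pDens_mul_le {N : ℕ} {s e σ ρ : ℝ} (hs : 0 < s) (hs1 : s ≤ 1)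
    (he : 0 ≤ e) (hq : 1 ≤ s + e) (hσ : 0 < σ) (hσρ : σ ≤ ρ) (μ : Measure (PSpace N)) [SFinite μ] :
    ∫⁻ z, pDens μ σ z ^ s * pDens μ ρ z ^ e ≤
      ENNReal.ofReal (3 ^ (N + 2)) ^ (s + e) * ENNReal.ofReal ((σ / ρ) ^ 2) ^ s *
        ∫⁻ z, pDens μ ρ z ^ (s + e) := by
  have hρ : 0 < ρ := hσ.trans_le hσρ
  set A := ENNReal.ofReal (σ ^ N)
  set B := ENNReal.ofReal (ρ ^ N)
  have hB0 : B ≠ 0 := by simpa [B] using pow_pos hρ N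
  have hBt : B ≠ ⊤ := by simp [B]
  have hA0 : A ≠ 0 := by simpa [A] using pow_pos hσ N
  have hAt : A ≠ ⊤ := by simp [A]
  have hm : Measurable fun z : PSpace N => μ (pQt N σ z) ^ s * μ (pQt N ρ z) ^ e :=
    ((measurable_measure_pQt _ μ).pow_const s).mul ((measurable_measure_pQt _ μ).pow_const e)
  have e1 : ∫⁻ z, pDens μ σ z ^ s * pDens μ ρ z ^ e =
      A⁻¹ ^ s * B⁻¹ ^ e * ∫⁻ z, μ (pQt N σ z) ^ s * μ (pQt N ρ z) ^ e := by
    rw [← lintegral_const_mul _ hm]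
    refine lintegral_congr fun z => ?_
    rw [pDens_rpow _ _ _ hs.le, pDens_rpow _ _ _ he]
    ring
  have e2 : ∫⁻ z, pDens μ ρ z ^ (s + e) = B⁻¹ ^ (s + e) * ∫⁻ z, μ (pQt N ρ z) ^ (s + e) := by
    rw [← lintegral_const_mul _ ((measurable_measure_pQt _ μ).pow_const _)]
    exact lintegral_congr fun z => pDens_rpow _ _ _ (by linarith)
  have e3 : A⁻¹ ^ s * B⁻¹ ^ e * ENNReal.ofReal ((σ / ρ) ^ (N + 2)) ^ s =
      ENNReal.ofReal ((σ / ρ) ^ 2) ^ s * B⁻¹ ^ (s + e) := by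
    have : ENNReal.ofReal ((σ / ρ) ^ (N + 2)) = A * B⁻¹ * ENNReal.ofReal ((σ / ρ) ^ 2) := by
      rw [pow_add, ENNReal.ofReal_mul (by positivity), div_pow,
        ENNReal.ofReal_div_of_pos (by positivity), div_eq_mul_inv]
    rw [this, ENNReal.rpow_add_of_nonneg _ _ hs.le he, ENNReal.mul_rpow_of_nonneg _ _ hs.le,
      ENNReal.mul_rpow_of_nonneg _ _ hs.le]
    have : A⁻¹ ^ s * A ^ s = 1 := by
      rw [← ENNReal.mul_rpow_of_nonneg _ _ hs.le, ENNReal.inv_mul_cancel hA0 hAt,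
        ENNReal.one_rpow]
    calc _ = (A⁻¹ ^ s * A ^ s) * (ENNReal.ofReal ((σ / ρ) ^ 2) ^ s * (B⁻¹ ^ s * B⁻¹ ^ e)) := by
          ring
      _ = _ := by rw [this, one_mul]
  have h1 := lintegral_measure_pQt_mul_le hs hs1 he hσ hσρ μ
  have h2 := lintegral_measure_pQt_rpow_le hq (zero_lt_two) hρ μ
  rw [e1, e2]
  calc _ ≤ A⁻¹ ^ s * B⁻¹ ^ e * (ENNReal.ofReal ((σ / ρ) ^ (N + 2)) ^ s *
        (ENNReal.ofReal ((2 + 1) ^ (N + 2)) ^ (s + e) * ∫⁻ z, μ (pQt N ρ z) ^ (s + e))) := by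
        gcongr
        exact h1.trans (by gcongr)
    _ = (A⁻¹ ^ s * B⁻¹ ^ e * ENNReal.ofReal ((σ / ρ) ^ (N + 2)) ^ s) *
        (ENNReal.ofReal ((2 + 1) ^ (N + 2)) ^ (s + e) * ∫⁻ z, μ (pQt N ρ z) ^ (s + e)) := by ring
    _ = _ := by
        rw [e3]
        norm_num
        ring

theorem ENNReal.add_rpow_le_tangent {r : ℝ} (hr : 1 ≤ r) (x a : ℝ≥0∞) :
    (x + a) ^ r ≤ x ^ r + ENNReal.ofReal r * a * (x + a) ^ (r - 1) := by
  have hr0 : 0 < r := by linarith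
  rcases eq_or_ne a 0 with rfl | ha0
  · simp
  rcases eq_or_ne a ⊤ with rfl | ha
  · have : ENNReal.ofReal r * ⊤ * (x + ⊤) ^ (r - 1) = ⊤ := by
      rw [ENNReal.mul_top (by simpa using hr0)]
      rcases hr.eq_or_lt with rfl | h
      · simp
      · simp [ENNReal.top_rpow_of_pos (sub_pos.2 h)]
    rw [this]; simp
  rcases eq_or_ne x ⊤ with rfl | hx
  · simp [ENNReal.top_rpow_of_pos hr0]
  lift x to ℝ≥0 using hx
  lift a to ℝ≥0 using ha
  have hy : 0 < (x : ℝ) + a := by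
    have : 0 < (a : ℝ) := by simpa [pos_iff_ne_zero] using ha0
    positivity
  have h := one_add_mul_self_le_rpow_one_add (s := x / (x + a) - 1)
    (by have : 0 ≤ (x : ℝ) / (x + a) := by positivity
        linarith) hr
  rw [add_sub_cancel, Real.div_rpow (by positivity) hy.le, le_div_iff₀ (by positivity)] at h
  have e1 : ((x : ℝ) + a) ^ r = (x + a) ^ (r - 1) * (x + a) := by
    rw [Real.rpow_sub_one hy.ne']; field_simp
  have key : ((x : ℝ) + a) ^ r ≤ (x : ℝ) ^ r + r * a * (x + a) ^ (r - 1) := by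
    have e2 : (1 + r * ((x : ℝ) / (x + a) - 1)) * (x + a) ^ r =
        (x + a) ^ r - r * a * (x + a) ^ (r - 1) := by
      rw [e1]; field_simp; ring
    linarith
  have e3 : ENNReal.ofReal r = ((Real.toNNReal r : ℝ≥0) : ℝ≥0∞) := rfl
  rw [e3, ← ENNReal.coe_add, ← ENNReal.coe_rpow_of_nonneg _ hr0.le,
    ← ENNReal.coe_rpow_of_nonneg _ hr0.le, ← ENNReal.coe_rpow_of_nonneg _ (by linarith),
    ← ENNReal.coe_mul, ← ENNReal.coe_mul, ← ENNReal.coe_add, ENNReal.coe_le_coe]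
  rw [← NNReal.coe_le_coe]
  push_cast
  rw [Real.coe_toNNReal r hr0.le]
  exact key

theorem ENNReal.sum_le_geometric_mul_weighted {η e : ℝ} (hη : 1 < η) (he : 0 < e) (a : ℕ → ℝ≥0∞)
    (k : ℕ) :
    (∑ j ∈ Finset.range (k + 1), a j) ^ e ≤ ((1 - (ENNReal.ofReal η)⁻¹)⁻¹) ^ e *
      ∑ j ∈ Finset.range (k + 1), (ENNReal.ofReal η ^ (k - j)) ^ e * a j ^ e := by
  set h := ENNReal.ofReal η
  have h0 : h ≠ 0 := by simp [h]; linarith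
  have ht : h ≠ ⊤ := by simp [h]
  obtain ⟨i, hi, him⟩ := Finset.exists_max_image (Finset.range (k + 1))
    (fun j => h ^ (k - j) * a j) ⟨0, by simp⟩
  have h1 : ∑ j ∈ Finset.range (k + 1), a j ≤ (1 - h⁻¹)⁻¹ * (h ^ (k - i) * a i) := by
    calc _ ≤ ∑ j ∈ Finset.range (k + 1), h⁻¹ ^ (k - j) * (h ^ (k - i) * a i) := by
          refine Finset.sum_le_sum fun j hj => ?_
          calc a j = h⁻¹ ^ (k - j) * (h ^ (k - j) * a j) := by
                rw [← mul_assoc, ← mul_pow, ENNReal.inv_mul_cancel h0 ht, one_pow, one_mul]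
            _ ≤ _ := by
                exact mul_le_mul_right (him j hj) _
      _ = (∑ j ∈ Finset.range (k + 1), h⁻¹ ^ j) * (h ^ (k - i) * a i) := by
          rw [← Finset.sum_mul, ← Finset.sum_range_reflect (fun j => h⁻¹ ^ j)]
          simp
      _ ≤ _ := by
          rw [← ENNReal.tsum_geometric]
          gcongr
          exact ENNReal.sum_le_tsum _
  calc _ ≤ ((1 - h⁻¹)⁻¹ * (h ^ (k - i) * a i)) ^ e := by gcongr
    _ = ((1 - h⁻¹)⁻¹) ^ e * ((h ^ (k - i)) ^ e * a i ^ e) := by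
        rw [ENNReal.mul_rpow_of_nonneg _ _ he.le, ENNReal.mul_rpow_of_nonneg _ _ he.le]
    _ ≤ _ := by
        gcongr
        exact Finset.single_le_sum (f := fun j => (h ^ (k - j)) ^ e * a j ^ e)
          (fun _ _ => zero_le) hi

theorem ENNReal.rpow_sum_le_sum_sum {η r : ℝ} (hη : 1 < η) (hr : 1 < r) (a : ℕ → ℝ≥0∞) (n : ℕ) :
    (∑ k ∈ Finset.range n, a k) ^ r ≤
      ENNReal.ofReal r * ((1 - (ENNReal.ofReal η)⁻¹)⁻¹) ^ (r - 1) *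
      ∑ k ∈ Finset.range n, ∑ j ∈ Finset.range (k + 1),
        (ENNReal.ofReal η ^ (k - j)) ^ (r - 1) * (a k * a j ^ (r - 1)) := by
  induction n with
  | zero => simp [show 0 < r by linarith]
  | succ n ih =>
    rw [Finset.sum_range_succ _ n, Finset.sum_range_succ (n := n), mul_add]
    refine (ENNReal.add_rpow_le_tangent hr.le _ _).trans (add_le_add ih ?_)
    have h := ENNReal.sum_le_geometric_mul_weighted hη (sub_pos.2 hr) a n
    rw [Finset.sum_range_succ] at h
    calc _ ≤ ENNReal.ofReal r * a n * (((1 - (ENNReal.ofReal η)⁻¹)⁻¹) ^ (r - 1) *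
      ∑ j ∈ Finset.range (n + 1), (ENNReal.ofReal η ^ (n - j)) ^ (r - 1) * a j ^ (r - 1)) := by
          gcongr
      _ = _ := by
          simp only [Finset.mul_sum]
          refine Finset.sum_congr rfl fun j _ => by ring

/-- A Wolff type inequality: for densities at dyadic scales, the `ℓ^s`-in-scale norm is controlled
in `L^q` by the `ℓ^q`-in-scale norm. -/
theorem exists_lintegral_sum_pDens_le (N : ℕ) {s q : ℝ} (hs : 0 < s) (hs1 : s ≤ 1) (hq : 1 < q) :
    ∃ C : ℝ≥0∞, C ≠ ⊤ ∧ ∀ (μ : Measure (PSpace N)) [SFinite μ] (ρ : ℝ), 0 < ρ → ∀ n : ℕ,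
      ∫⁻ z, (∑ k ∈ Finset.range n, pDens μ (ρ / 2 ^ k) z ^ s) ^ (q / s) ≤
        C * ∑ k ∈ Finset.range n, ∫⁻ z, pDens μ (ρ / 2 ^ k) z ^ q := by
  have hsq : s < q := by linarith
  set r := q / s with hr
  have hr1 : 1 < r := (one_lt_div hs).2 hsq
  have hre : s * (r - 1) = q - s := by rw [hr]; field_simp
  set η : ℝ := 2 ^ (s / (r - 1)) with hη
  have hη1 : 1 < η := Real.one_lt_rpow (by norm_num) (div_pos hs (by linarith))
  have hη2 (i : ℕ) : (ENNReal.ofReal η ^ i) ^ (r - 1) = (2 ^ i) ^ s := by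
    rw [← ENNReal.ofReal_rpow_of_pos (by norm_num), ← ENNReal.rpow_natCast, ← ENNReal.rpow_mul,
      ← ENNReal.rpow_mul, ← ENNReal.rpow_natCast, ← ENNReal.rpow_mul]
    simp only [ENNReal.ofReal_ofNat]
    congr 1
    have : r - 1 ≠ 0 := by linarith
    field_simp
  set A : ℝ≥0∞ := ENNReal.ofReal r * ((1 - (ENNReal.ofReal η)⁻¹)⁻¹) ^ (r - 1) with hA
  have hAt : A ≠ ⊤ := by
    refine ENNReal.mul_ne_top (by simp) (ENNReal.rpow_ne_top_of_nonneg (by linarith) ?_)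
    rw [ENNReal.inv_ne_top, ← pos_iff_ne_zero, tsub_pos_iff_lt, ENNReal.inv_lt_one]
    simpa using hη1
  set B : ℝ≥0∞ := ENNReal.ofReal (3 ^ (N + 2)) ^ q with hB
  have hBt : B ≠ ⊤ := ENNReal.rpow_ne_top_of_nonneg (by linarith) (by simp)
  set x : ℝ≥0∞ := (2⁻¹ : ℝ≥0∞) ^ s with hx
  have hx1 : x < 1 := ENNReal.rpow_lt_one (by simp) hs
  refine ⟨A * (B * (1 - x)⁻¹), ENNReal.mul_ne_top hAt (ENNReal.mul_ne_top hBt ?_), ?_⟩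
  · rw [ENNReal.inv_ne_top, ← pos_iff_ne_zero, tsub_pos_iff_lt]
    exact hx1
  intro μ _ ρ hρ n
  have hm (k j : ℕ) : Measurable fun z : PSpace N =>
      pDens μ (ρ / 2 ^ k) z ^ s * (pDens μ (ρ / 2 ^ j) z ^ s) ^ (r - 1) :=
    ((measurable_pDens μ _).pow_const s).mul (((measurable_pDens μ _).pow_const s).pow_const _)
  have key (k j : ℕ) (hjk : j ≤ k) : (ENNReal.ofReal η ^ (k - j)) ^ (r - 1) *
      ∫⁻ z, pDens μ (ρ / 2 ^ k) z ^ s * (pDens μ (ρ / 2 ^ j) z ^ s) ^ (r - 1) ≤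
      B * (x ^ (k - j) * ∫⁻ z, pDens μ (ρ / 2 ^ j) z ^ q) := by
    simp_rw [← ENNReal.rpow_mul, hre, hη2]
    have h := lintegral_pDens_mul_le (σ := ρ / 2 ^ k) (ρ := ρ / 2 ^ j) hs hs1
      (e := q - s) (by linarith) (by linarith) (by positivity)
      (by gcongr; norm_num) μ
    rw [add_sub_cancel] at h
    refine (mul_le_mul_right h _).trans (le_of_eq ?_)
    have e1 : ρ / 2 ^ k / (ρ / 2 ^ j) = (1 / 2) ^ (k - j) := by
      obtain ⟨i, rfl⟩ := Nat.exists_eq_add_of_le hjk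
      rw [Nat.add_sub_cancel_left, pow_add, one_div_pow]; field_simp
    have e2 : ((2 : ℝ≥0∞) ^ (k - j)) ^ s * ENNReal.ofReal (((1 / 2) ^ (k - j)) ^ 2) ^ s =
        x ^ (k - j) := by
      rw [← ENNReal.mul_rpow_of_nonneg _ _ hs.le, hx, ← ENNReal.rpow_natCast (2⁻¹ ^ s),
        ← ENNReal.rpow_mul, mul_comm s, ENNReal.rpow_mul, ENNReal.rpow_natCast]
      congr 1
      rw [ENNReal.ofReal_pow (by positivity), ENNReal.ofReal_pow (by positivity), ← pow_mul,
        mul_comm _ 2, pow_mul, ← mul_pow]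
      congr 1
      rw [one_div, ENNReal.ofReal_inv_of_pos (by norm_num), ENNReal.ofReal_ofNat, sq, ← mul_assoc,
        ENNReal.mul_inv_cancel (by simp) (by simp), one_mul]
    rw [e1, ← e2]
    ring
  calc _ ≤ ∫⁻ z, A * ∑ k ∈ Finset.range n, ∑ j ∈ Finset.range (k + 1),
        (ENNReal.ofReal η ^ (k - j)) ^ (r - 1) *
          (pDens μ (ρ / 2 ^ k) z ^ s * (pDens μ (ρ / 2 ^ j) z ^ s) ^ (r - 1)) :=
        lintegral_mono fun z => ENNReal.rpow_sum_le_sum_sum hη1 hr1 _ n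
    _ = A * ∑ k ∈ Finset.range n, ∑ j ∈ Finset.range (k + 1),
        (ENNReal.ofReal η ^ (k - j)) ^ (r - 1) *
          ∫⁻ z, pDens μ (ρ / 2 ^ k) z ^ s * (pDens μ (ρ / 2 ^ j) z ^ s) ^ (r - 1) := by
        rw [lintegral_const_mul' _ _ hAt, lintegral_finsetSum _ fun k _ =>
          Finset.measurable_sum _ fun j _ => (hm k j).const_mul _]
        congr 1
        refine Finset.sum_congr rfl fun k _ => ?_
        rw [lintegral_finsetSum _ fun j _ => (hm k j).const_mul _]
        exact Finset.sum_congr rfl fun j _ => lintegral_const_mul _ (hm k j)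
    _ ≤ A * ∑ k ∈ Finset.range n, ∑ j ∈ Finset.range (k + 1),
        B * (x ^ (k - j) * ∫⁻ z, pDens μ (ρ / 2 ^ j) z ^ q) := by
        refine mul_le_mul_right (Finset.sum_le_sum fun k _ => Finset.sum_le_sum fun j hj => ?_) _
        exact key k j (by simpa [Nat.lt_succ_iff] using hj)
    _ = A * (B * ∑ j ∈ Finset.range n, ∑ k ∈ Finset.Ico j n,
        x ^ (k - j) * ∫⁻ z, pDens μ (ρ / 2 ^ j) z ^ q) := by
        simp_rw [← Finset.mul_sum _ _ B]
        congr 2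
        refine Finset.sum_comm' fun k j => ?_
        simp only [Finset.mem_range, Finset.mem_Ico]
        omega
    _ ≤ A * (B * ∑ j ∈ Finset.range n, (1 - x)⁻¹ * ∫⁻ z, pDens μ (ρ / 2 ^ j) z ^ q) := by
        gcongr with j hj
        rw [← Finset.sum_mul, Finset.sum_Ico_eq_sum_range]
        gcongr
        simp only [Nat.add_sub_cancel_left]
        rw [← ENNReal.tsum_geometric]
        exact ENNReal.sum_le_tsum _
    _ = _ := by rw [← Finset.mul_sum]; ring

section Derivatives

variable {N : ℕ}

theorem tDeriv_eq_fderiv {u : PSpace N → ℝ} {z : PSpace N} (hu : DifferentiableAt ℝ u z) :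
    tDeriv u z = fderiv ℝ u z (0, 1) := by
  have h : HasDerivAt (fun s : ℝ => (z.1, s)) ((0 : EuclideanSpace ℝ (Fin N)), (1 : ℝ)) z.2 :=
    (hasDerivAt_const _ _).prodMk (hasDerivAt_id _)
  exact (hu.hasFDerivAt.comp_hasDerivAt z.2 h).deriv

theorem xDeriv_eq_fderiv {u : PSpace N → ℝ} {z : PSpace N} (hu : DifferentiableAt ℝ u z)
    (i : Fin N) : xDeriv i u z = fderiv ℝ u z (EuclideanSpace.single i 1, 0) := by
  have h : HasDerivAt (fun s : ℝ => (z.1 + s • EuclideanSpace.single i (1 : ℝ), z.2))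
      (EuclideanSpace.single i (1 : ℝ), (0 : ℝ)) 0 := by
    refine HasDerivAt.prodMk ?_ (hasDerivAt_const _ _)
    simpa using ((hasDerivAt_id (0 : ℝ)).smul_const (EuclideanSpace.single i (1 : ℝ))).const_add z.1
  have hu' : HasFDerivAt u (fderiv ℝ u z) (z.1 + (0 : ℝ) • EuclideanSpace.single i (1 : ℝ), z.2) := by
    simpa using hu.hasFDerivAt
  exact (hu'.comp_hasDerivAt (0 : ℝ) h).deriv

theorem tDeriv_eq_of_contDiff {u : PSpace N → ℝ} (hu : ContDiff ℝ ∞ u) :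
    tDeriv u = fun z => fderiv ℝ u z (0, 1) :=
  funext fun z => tDeriv_eq_fderiv (hu.differentiable (by simp) z)

theorem xDeriv_eq_of_contDiff {u : PSpace N → ℝ} (hu : ContDiff ℝ ∞ u) (i : Fin N) :
    xDeriv i u = fun z => fderiv ℝ u z (EuclideanSpace.single i 1, 0) :=
  funext fun z => xDeriv_eq_fderiv (hu.differentiable (by simp) z) i

theorem contDiff_fderiv_const {u : PSpace N → ℝ} (hu : ContDiff ℝ ∞ u) (v : PSpace N) :
    ContDiff ℝ ∞ fun z => fderiv ℝ u z v :=
  (hu.fderiv_right (m := ∞) (by simp)).clm_apply contDiff_const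

theorem contDiff_tDeriv {u : PSpace N → ℝ} (hu : ContDiff ℝ ∞ u) : ContDiff ℝ ∞ (tDeriv u) := by
  rw [tDeriv_eq_of_contDiff hu]; exact contDiff_fderiv_const hu _

theorem contDiff_xDeriv {u : PSpace N → ℝ} (hu : ContDiff ℝ ∞ u) (i : Fin N) :
    ContDiff ℝ ∞ (xDeriv i u) := by
  rw [xDeriv_eq_of_contDiff hu]; exact contDiff_fderiv_const hu _

theorem hasCompactSupport_xDeriv {u : PSpace N → ℝ} (hu : ContDiff ℝ ∞ u)
    (hc : HasCompactSupport u) (i : Fin N) : HasCompactSupport (xDeriv i u) := by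
  rw [xDeriv_eq_of_contDiff hu]; exact hc.fderiv_apply ℝ _

theorem contDiff_xxDeriv {u : PSpace N → ℝ} (hu : ContDiff ℝ ∞ u) (i j : Fin N) :
    ContDiff ℝ ∞ (xxDeriv i j u) :=
  contDiff_xDeriv (contDiff_xDeriv hu j) i

theorem tDeriv_add {u v : PSpace N → ℝ} (hu : ContDiff ℝ ∞ u) (hv : ContDiff ℝ ∞ v) :
    tDeriv (fun z => u z + v z) = fun z => tDeriv u z + tDeriv v z := by
  rw [tDeriv_eq_of_contDiff hu, tDeriv_eq_of_contDiff hv, tDeriv_eq_of_contDiff (hu.add hv)]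
  funext z
  rw [fderiv_fun_add (hu.differentiable (by simp) z) (hv.differentiable (by simp) z)]; rfl

theorem xDeriv_add {u v : PSpace N → ℝ} (hu : ContDiff ℝ ∞ u) (hv : ContDiff ℝ ∞ v) (i : Fin N) :
    xDeriv i (fun z => u z + v z) = fun z => xDeriv i u z + xDeriv i v z := by
  rw [xDeriv_eq_of_contDiff hu, xDeriv_eq_of_contDiff hv, xDeriv_eq_of_contDiff (hu.add hv)]
  funext z
  rw [fderiv_fun_add (hu.differentiable (by simp) z) (hv.differentiable (by simp) z)]; rfl

theorem xxDeriv_add {u v : PSpace N → ℝ} (hu : ContDiff ℝ ∞ u) (hv : ContDiff ℝ ∞ v)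
    (i j : Fin N) :
    xxDeriv i j (fun z => u z + v z) = fun z => xxDeriv i j u z + xxDeriv i j v z := by
  funext z
  rw [xxDeriv, xDeriv_add hu hv, xDeriv_add (contDiff_xDeriv hu j) (contDiff_xDeriv hv j)]
  rfl

theorem tDeriv_const_mul {u : PSpace N → ℝ} (hu : ContDiff ℝ ∞ u) (c : ℝ) :
    tDeriv (fun z => c * u z) = fun z => c * tDeriv u z := by
  rw [tDeriv_eq_of_contDiff hu, tDeriv_eq_of_contDiff (contDiff_const.mul hu)]
  funext z
  rw [fderiv_const_mul (hu.differentiable (by simp) z)]; rfl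

theorem xDeriv_const_mul {u : PSpace N → ℝ} (hu : ContDiff ℝ ∞ u) (c : ℝ) (i : Fin N) :
    xDeriv i (fun z => c * u z) = fun z => c * xDeriv i u z := by
  rw [xDeriv_eq_of_contDiff hu, xDeriv_eq_of_contDiff (contDiff_const.mul hu)]
  funext z
  rw [fderiv_const_mul (hu.differentiable (by simp) z)]; rfl

theorem xxDeriv_const_mul {u : PSpace N → ℝ} (hu : ContDiff ℝ ∞ u) (c : ℝ) (i j : Fin N) :
    xxDeriv i j (fun z => c * u z) = fun z => c * xxDeriv i j u z := by
  funext z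
  rw [xxDeriv, xDeriv_const_mul hu, xDeriv_const_mul (contDiff_xDeriv hu j)]
  rfl

end Derivatives

/-- The function `G` dominates `u` and its parabolic derivatives of order at most two. -/
structure W21Dominated {N : ℕ} (u : PSpace N → ℝ) (G : PSpace N → ℝ≥0∞) : Prop where
  val : ∀ z, ‖u z‖ₑ ≤ G z
  time : ∀ z, ‖tDeriv u z‖ₑ ≤ G z
  space : ∀ i z, ‖xDeriv i u z‖ₑ ≤ G z
  hess : ∀ i j z, ‖xxDeriv i j u z‖ₑ ≤ G z

namespace W21Dominated

variable {N : ℕ} {u v : PSpace N → ℝ} {G H : PSpace N → ℝ≥0∞}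

theorem mono (h : W21Dominated u G) (hGH : ∀ z, G z ≤ H z) : W21Dominated u H :=
  ⟨fun z => (h.val z).trans (hGH z), fun z => (h.time z).trans (hGH z),
    fun i z => (h.space i z).trans (hGH z), fun i j z => (h.hess i j z).trans (hGH z)⟩

theorem add (hu : ContDiff ℝ ∞ u) (hv : ContDiff ℝ ∞ v) (h : W21Dominated u G)
    (h' : W21Dominated v H) : W21Dominated (fun z => u z + v z) fun z => G z + H z where
  val z := (enorm_add_le _ _).trans (add_le_add (h.val z) (h'.val z))
  time z := by
    rw [tDeriv_add hu hv]; exact (enorm_add_le _ _).trans (add_le_add (h.time z) (h'.time z))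
  space i z := by
    rw [xDeriv_add hu hv]; exact (enorm_add_le _ _).trans (add_le_add (h.space i z) (h'.space i z))
  hess i j z := by
    rw [xxDeriv_add hu hv]
    exact (enorm_add_le _ _).trans (add_le_add (h.hess i j z) (h'.hess i j z))

theorem const_mul (hu : ContDiff ℝ ∞ u) (h : W21Dominated u G) (c : ℝ) :
    W21Dominated (fun z => c * u z) fun z => ‖c‖ₑ * G z where
  val z := by rw [enorm_mul]; gcongr; exact h.val z
  time z := by rw [tDeriv_const_mul hu, enorm_mul]; gcongr; exact h.time z
  space i z := by rw [xDeriv_const_mul hu, enorm_mul]; gcongr; exact h.space i z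
  hess i j z := by rw [xxDeriv_const_mul hu, enorm_mul]; gcongr; exact h.hess i j z

theorem zero : W21Dominated (fun _ : PSpace N => (0 : ℝ)) fun _ => 0 := by
  have hx : ∀ i : Fin N, xDeriv i (fun _ : PSpace N => (0 : ℝ)) = fun _ => 0 := fun i => by
    rw [xDeriv_eq_of_contDiff contDiff_const]; simp
  have ht : tDeriv (fun _ : PSpace N => (0 : ℝ)) = fun _ => 0 := by
    rw [tDeriv_eq_of_contDiff contDiff_const]; simp
  exact ⟨by simp, by simp [ht], by simp [hx], by simp [xxDeriv, hx]⟩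

theorem sum {ι : Type*} (s : Finset ι) {u : ι → PSpace N → ℝ} {G : ι → PSpace N → ℝ≥0∞}
    (hu : ∀ k, ContDiff ℝ ∞ (u k)) (h : ∀ k, W21Dominated (u k) (G k)) :
    W21Dominated (fun z => ∑ k ∈ s, u k z) fun z => ∑ k ∈ s, G k z := by
  classical
  induction s using Finset.induction_on with
  | empty => simpa using zero
  | insert a s ha ih =>
    simp_rw [Finset.sum_insert ha]
    exact add (hu a) (ContDiff.sum fun k _ => hu k) (h a) ih

theorem enorm_gradNorm_le (h : W21Dominated u G) (z : PSpace N) :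
    ‖gradNorm u z‖ₑ ≤ N * G z := by
  have h1 : gradNorm u z ≤ ∑ i : Fin N, |xDeriv i u z| := by
    rw [gradNorm]
    refine Real.sqrt_le_iff.2 ⟨Finset.sum_nonneg fun _ _ => abs_nonneg _, ?_⟩
    simp_rw [← sq_abs (xDeriv _ u z)]
    exact Finset.sum_sq_le_sq_sum_of_nonneg fun _ _ => abs_nonneg _
  calc ‖gradNorm u z‖ₑ = ENNReal.ofReal (gradNorm u z) :=
        Real.enorm_of_nonneg (Real.sqrt_nonneg _)
    _ ≤ ENNReal.ofReal (∑ i : Fin N, |xDeriv i u z|) := ENNReal.ofReal_le_ofReal h1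
    _ = ∑ i : Fin N, ‖xDeriv i u z‖ₑ := by
        rw [ENNReal.ofReal_sum_of_nonneg fun _ _ => abs_nonneg _]
        simp [Real.enorm_eq_ofReal_abs]
    _ ≤ ∑ _i : Fin N, G z := Finset.sum_le_sum fun i _ => h.space i z
    _ = N * G z := by simp

theorem ofReal_W21Norm_le {p : ℝ} (hp : 0 < p) (h : W21Dominated u G) :
    ENNReal.ofReal (W21Norm N p u) ≤
      ((N : ℝ≥0∞) ^ 2 + N + 2) * (∫⁻ z, G z ^ p) ^ (1 / p) := by
  have key : ∀ (f : PSpace N → ℝ) (c : ℝ≥0∞), c ≠ ⊤ → (∀ z, ‖f z‖ₑ ≤ c * G z) →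
      ENNReal.ofReal ((eLpNorm f (ENNReal.ofReal p) volume).toReal) ≤
        c * (∫⁻ z, G z ^ p) ^ (1 / p) := by
    intro f c hc hf
    refine ENNReal.ofReal_toReal_le.trans ?_
    rw [eLpNorm_eq_lintegral_rpow_enorm_toReal (by simpa using hp) (by simp),
      ENNReal.toReal_ofReal hp.le]
    calc (∫⁻ z, ‖f z‖ₑ ^ p) ^ (1 / p) ≤ (∫⁻ z, c ^ p * G z ^ p) ^ (1 / p) := by
          gcongr with z
          rw [← ENNReal.mul_rpow_of_nonneg _ _ hp.le]
          gcongr; exact hf z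
      _ = _ := by
          rw [lintegral_const_mul' _ _ (ENNReal.rpow_ne_top_of_nonneg hp.le hc),
            ENNReal.mul_rpow_of_nonneg _ _ (by positivity), ← ENNReal.rpow_mul,
            mul_one_div_cancel hp.ne', ENNReal.rpow_one]
  set I := (∫⁻ z, G z ^ p) ^ (1 / p)
  have h1 := key u 1 (by simp) (by simpa using h.val)
  have h2 := key _ 1 (by simp) (by simpa using h.time)
  have h3 := key _ N (by simp) h.enorm_gradNorm_le
  have h4 := fun i j => key _ 1 (by simp) (by simpa using h.hess i j)
  rw [W21Norm]
  refine ENNReal.ofReal_add_le.trans ?_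
  refine (add_le_add_left ENNReal.ofReal_add_le _).trans ?_
  refine (add_le_add_left (add_le_add_left ENNReal.ofReal_add_le _) _).trans ?_
  rw [ENNReal.ofReal_sum_of_nonneg
    fun _ _ => Finset.sum_nonneg fun _ _ => ENNReal.toReal_nonneg]
  simp_rw [ENNReal.ofReal_sum_of_nonneg fun _ _ => ENNReal.toReal_nonneg]
  refine (add_le_add (add_le_add (add_le_add h1 h2) h3)
    (Finset.sum_le_sum fun i _ => Finset.sum_le_sum fun j _ => h4 i j)).trans (le_of_eq ?_)
  simp; ring

end W21Dominated

section Scaling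

variable {N : ℕ}

/-- The parabolic rescaling `(x, t) ↦ (x / ρ, t / ρ²)`. -/
noncomputable def pScale (N : ℕ) (ρ : ℝ) (z : PSpace N) : PSpace N := (ρ⁻¹ • z.1, (ρ ^ 2)⁻¹ * z.2)

theorem contDiff_pScale (ρ : ℝ) : ContDiff ℝ ∞ (pScale N ρ) := by
  unfold pScale; fun_prop

theorem pScale_mem_pQt {ρ r : ℝ} (hρ : 0 < ρ) (z : PSpace N) :
    pScale N ρ z ∈ pQt N r 0 ↔ z ∈ pQt N (r * ρ) 0 := by
  simp only [mem_pQt, pScale, Prod.fst_zero, Prod.snd_zero, dist_zero_right, sub_zero, norm_smul,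
    abs_mul, norm_inv, Real.norm_eq_abs, abs_inv, abs_pow, abs_of_pos hρ]
  rw [inv_mul_lt_iff₀ hρ, inv_mul_lt_iff₀ (by positivity), mul_comm ρ, mul_pow, mul_comm (ρ ^ 2)]

theorem tDeriv_comp_pScale (u : PSpace N → ℝ) (ρ : ℝ) (z : PSpace N) :
    tDeriv (fun w => u (pScale N ρ w)) z = (ρ ^ 2)⁻¹ * tDeriv u (pScale N ρ z) := by
  simp only [tDeriv, pScale]
  exact deriv_comp_mul_left _ (fun s => u (ρ⁻¹ • z.1, s)) _

theorem xDeriv_comp_pScale (u : PSpace N → ℝ) (ρ : ℝ) (i : Fin N) (z : PSpace N) :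
    xDeriv i (fun w => u (pScale N ρ w)) z = ρ⁻¹ * xDeriv i u (pScale N ρ z) := by
  simp only [xDeriv, pScale, lineDeriv]
  have := deriv_comp_mul_left ρ⁻¹
    (fun t => u (ρ⁻¹ • z.1 + t • EuclideanSpace.single i 1, (ρ ^ 2)⁻¹ * z.2)) 0
  rw [mul_zero] at this
  rw [← smul_eq_mul ρ⁻¹ (deriv _ _), ← this]
  simp only [smul_add, smul_smul]

theorem xxDeriv_comp_pScale (u : PSpace N → ℝ) (ρ : ℝ) (i j : Fin N) (z : PSpace N) :
    xxDeriv i j (fun w => u (pScale N ρ w)) z = (ρ ^ 2)⁻¹ * xxDeriv i j u (pScale N ρ z) := by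
  have h : xDeriv j (fun w => u (pScale N ρ w)) =
      fun w => (fun v => ρ⁻¹ * xDeriv j u v) (pScale N ρ w) :=
    funext fun w => xDeriv_comp_pScale u ρ j w
  rw [xxDeriv, h, xDeriv_comp_pScale fun v => ρ⁻¹ * xDeriv j u v, xxDeriv]
  simp only [xDeriv, lineDeriv]
  rw [deriv_const_mul_field]
  ring

theorem exists_bump (N : ℕ) : ∃ g : PSpace N → ℝ, ContDiff ℝ ∞ g ∧ (∀ z, 0 ≤ g z) ∧
    (∀ z ∈ pQt N 1 0, g z = 1) ∧ ∃ M : ℝ, 0 ≤ M ∧ ∀ f : PSpace N → ℝ,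
      (f = g ∨ f = tDeriv g ∨ (∃ i, f = xDeriv i g) ∨ ∃ i j, f = xxDeriv i j g) →
        ∀ z, |f z| ≤ M ∧ (z ∉ pQt N 2 0 → f z = 0) := by
  let b : ContDiffBump (0 : PSpace N) := ⟨1, 3 / 2, by norm_num, by norm_num⟩
  have hb : ContDiff ℝ ∞ (b : PSpace N → ℝ) := b.contDiff
  have hsub : ∀ {f : PSpace N → ℝ} (v : PSpace N), ContDiff ℝ ∞ f → tsupport f ⊆ closedBall 0 (3 / 2) →
      tsupport (fun z => fderiv ℝ f z v) ⊆ closedBall 0 (3 / 2) :=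
    fun {f} v _ h => (tsupport_fderiv_apply_subset ℝ v).trans h
  have key : ∀ f : PSpace N → ℝ, (f = b ∨ f = tDeriv b ∨ (∃ i, f = xDeriv i b) ∨
      ∃ i j, f = xxDeriv i j b) → Continuous f ∧ tsupport f ⊆ closedBall 0 (3 / 2) := by
    have h0 : tsupport (b : PSpace N → ℝ) ⊆ closedBall 0 (3 / 2) := b.tsupport_eq.le
    rintro f (rfl | rfl | ⟨i, rfl⟩ | ⟨i, j, rfl⟩)
    · exact ⟨hb.continuous, h0⟩
    · exact ⟨(contDiff_tDeriv hb).continuous, by rw [tDeriv_eq_of_contDiff hb]; exact hsub _ hb h0⟩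
    · exact ⟨(contDiff_xDeriv hb i).continuous, by
        rw [xDeriv_eq_of_contDiff hb]; exact hsub _ hb h0⟩
    · refine ⟨(contDiff_xxDeriv hb i j).continuous, ?_⟩
      change tsupport (xDeriv i (xDeriv j b)) ⊆ _
      rw [xDeriv_eq_of_contDiff (contDiff_xDeriv hb j)]
      refine hsub _ (contDiff_xDeriv hb j) ?_
      rw [xDeriv_eq_of_contDiff hb]; exact hsub _ hb h0
  have hex : ∀ f : PSpace N → ℝ, Continuous f → tsupport f ⊆ closedBall 0 (3 / 2) →
      ∃ M : ℝ, 0 ≤ M ∧ ∀ z, |f z| ≤ M := by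
    intro f hf hs
    obtain ⟨M, hM⟩ := (HasCompactSupport.of_support_subset_isCompact
      (isCompact_closedBall (0 : PSpace N) (3 / 2))
      ((subset_tsupport f).trans hs)).exists_bound_of_continuous hf
    exact ⟨M, (abs_nonneg _).trans (hM 0), hM⟩
  have hk := fun f hf => hex f (key f hf).1 (key f hf).2
  obtain ⟨M0, hM0, h0⟩ := hk b (.inl rfl)
  obtain ⟨M1, hM1, h1⟩ := hk _ (.inr (.inl rfl))
  choose M2 hM2 h2 using fun i => hk _ (.inr (.inr (.inl ⟨i, rfl⟩)))
  choose M3 hM3 h3 using fun i j => hk _ (.inr (.inr (.inr ⟨i, j, rfl⟩)))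
  refine ⟨b, hb, fun z => b.nonneg, fun z hz => b.one_of_mem_closedBall ?_,
    M0 + M1 + ∑ i, M2 i + ∑ i, ∑ j, M3 i j, ?_, fun f hf z => ⟨?_, fun hz => ?_⟩⟩
  · rw [mem_pQt] at hz
    rw [mem_closedBall, Prod.dist_eq]
    refine max_le hz.1.le ?_
    have := hz.2.le
    rw [one_pow] at this
    rwa [Real.dist_eq]
  · have := Finset.sum_nonneg fun i (_ : i ∈ Finset.univ) => hM2 i
    have := Finset.sum_nonneg fun i (_ : i ∈ Finset.univ) =>
      Finset.sum_nonneg fun j (_ : j ∈ Finset.univ) => hM3 i j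
    positivity
  · have a2 := Finset.sum_nonneg fun i (_ : i ∈ Finset.univ) => hM2 i
    have a3 := Finset.sum_nonneg fun i (_ : i ∈ Finset.univ) =>
      Finset.sum_nonneg fun j (_ : j ∈ Finset.univ) => hM3 i j
    rcases hf with rfl | rfl | ⟨i, rfl⟩ | ⟨i, j, rfl⟩
    · linarith [h0 z]
    · linarith [h1 z]
    · have := Finset.single_le_sum (fun i _ => hM2 i) (Finset.mem_univ i)
      linarith [h2 i z]
    · have b1 := Finset.single_le_sum (f := fun i => ∑ j, M3 i j)
        (fun i _ => Finset.sum_nonneg fun j (_ : j ∈ Finset.univ) => hM3 i j) (Finset.mem_univ i)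
      have b2 := Finset.single_le_sum (fun j _ => hM3 i j) (Finset.mem_univ j)
      linarith [h3 i j z]
  · by_contra hne
    have := (key f hf).2 (subset_tsupport f hne)
    refine hz (mem_pQt.2 ?_)
    rw [mem_closedBall, Prod.dist_eq] at this
    refine ⟨(le_max_left _ _).trans_lt (this.trans_lt (by norm_num)), ?_⟩
    rw [← Real.dist_eq]
    exact (le_max_right _ _).trans_lt (this.trans_lt (by norm_num))

/-- Cutoff functions of parabolic cylinders, with bounds on derivatives. -/
theorem exists_cutoff (N : ℕ) (ρ₀ : ℝ) : ∃ M : ℝ, 0 ≤ M ∧ ∀ ρ, 0 < ρ → ρ ≤ ρ₀ →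
    ∃ g : PSpace N → ℝ, ContDiff ℝ ∞ g ∧ HasCompactSupport g ∧ (∀ z, 0 ≤ g z) ∧
      (∀ z ∈ pQt N ρ 0, g z = 1) ∧
      W21Dominated g ((pQt N (2 * ρ) 0).indicator fun _ => ENNReal.ofReal (M * (ρ ^ 2)⁻¹)) := by
  obtain ⟨g, hg, hg0, hg1, M, hM, hgM⟩ := exists_bump N
  refine ⟨M * (1 + ρ₀) ^ 2, by positivity, fun ρ hρ hρρ => ⟨fun z => g (pScale N ρ z),
    hg.comp (contDiff_pScale ρ), ?_, fun z => hg0 _, fun z hz => hg1 _ ?_, ?_⟩⟩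
  · refine HasCompactSupport.of_support_subset_isCompact
      ((isCompact_closedBall (0 : EuclideanSpace ℝ (Fin N)) (2 * ρ)).prod
        (isCompact_Icc (a := 0 - (2 * ρ) ^ 2) (b := 0 + (2 * ρ) ^ 2))) fun z hz => ?_
    have h2 : z ∈ pQt N (2 * ρ) 0 := by
      rw [← pScale_mem_pQt hρ]
      by_contra h
      exact hz ((hgM g (.inl rfl) _).2 h)
    exact ⟨ball_subset_closedBall h2.1, Ioo_subset_Icc_self h2.2⟩
  · rwa [pScale_mem_pQt hρ, one_mul]
  · have key : ∀ f : PSpace N → ℝ,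
      (f = g ∨ f = tDeriv g ∨ (∃ i, f = xDeriv i g) ∨ ∃ i j, f = xxDeriv i j g) → ∀ c : ℝ,
        0 ≤ c → c ≤ (1 + ρ₀) ^ 2 * (ρ ^ 2)⁻¹ → ∀ z, ‖c * f (pScale N ρ z)‖ₑ ≤
        (pQt N (2 * ρ) 0).indicator
          (fun _ => ENNReal.ofReal (M * (1 + ρ₀) ^ 2 * (ρ ^ 2)⁻¹)) z := by
      intro f hf c hc0 hc z
      obtain ⟨h1, h2⟩ := hgM f hf (pScale N ρ z)
      by_cases hz : z ∈ pQt N (2 * ρ) 0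
      · rw [indicator_of_mem hz, Real.enorm_eq_ofReal_abs, abs_mul, abs_of_nonneg hc0]
        refine ENNReal.ofReal_le_ofReal ?_
        calc c * |f (pScale N ρ z)| ≤ ((1 + ρ₀) ^ 2 * (ρ ^ 2)⁻¹) * M := by gcongr
          _ = _ := by ring
      · rw [h2 (by rwa [pScale_mem_pQt hρ])]; simp
    have hc0 : (1 : ℝ) ≤ (1 + ρ₀) ^ 2 * (ρ ^ 2)⁻¹ := by
      rw [← div_eq_mul_inv, one_le_div (by positivity)]; gcongr; linarith
    have hc1 : ρ⁻¹ ≤ (1 + ρ₀) ^ 2 * (ρ ^ 2)⁻¹ := by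
      rw [← div_eq_mul_inv, inv_eq_one_div, div_le_div_iff₀ hρ (by positivity)]
      have : ρ ≤ (1 + ρ₀) ^ 2 := by nlinarith
      nlinarith
    have hc2 : (ρ ^ 2)⁻¹ ≤ (1 + ρ₀) ^ 2 * (ρ ^ 2)⁻¹ := by
      refine le_mul_of_one_le_left (by positivity) ?_
      nlinarith
    refine ⟨fun z => by simpa using key g (.inl rfl) 1 (by simp) hc0 z, fun z => ?_,
      fun i z => ?_, fun i j z => ?_⟩
    · rw [tDeriv_comp_pScale]; exact key _ (.inr (.inl rfl)) _ (by positivity) hc2 z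
    · rw [xDeriv_comp_pScale]
      exact key _ (.inr (.inr (.inl ⟨i, rfl⟩))) _ (by positivity) hc1 z
    · rw [xxDeriv_comp_pScale]
      exact key _ (.inr (.inr (.inr ⟨i, j, rfl⟩))) _ (by positivity) hc2 z

end Scaling

instance isAddHaarMeasure_volume_pSpace (N : ℕ) :
    (volume : Measure (PSpace N)).IsAddHaarMeasure :=
  inferInstanceAs ((volume : Measure (EuclideanSpace ℝ (Fin N))).prod
    (volume : Measure ℝ)).IsAddHaarMeasure

section Convolution

open scoped Convolution

variable {N : ℕ}


/-- Convolution on space-time. -/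
noncomputable def pConv (f g : PSpace N → ℝ) (z : PSpace N) : ℝ := ∫ w, f w * g (z - w)

theorem pConv_eq (f g : PSpace N → ℝ) :
    pConv f g = (f ⋆[ContinuousLinearMap.mul ℝ ℝ, volume] g) := rfl

variable {f g : PSpace N → ℝ}

theorem contDiff_pConv (hf : LocallyIntegrable f volume) (hg : ContDiff ℝ ∞ g)
    (hc : HasCompactSupport g) : ContDiff ℝ ∞ (pConv f g) := by
  rw [pConv_eq]; exact hc.contDiff_convolution_right _ hf hg

theorem hasCompactSupport_pConv (hf : HasCompactSupport f) (hc : HasCompactSupport g) :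
    HasCompactSupport (pConv f g) := by
  rw [pConv_eq]; exact hf.convolution _ hc

theorem fderiv_pConv (hf : LocallyIntegrable f volume) (hg : ContDiff ℝ ∞ g)
    (hc : HasCompactSupport g) (z v : PSpace N) :
    fderiv ℝ (pConv f g) z v = pConv f (fun w => fderiv ℝ g w v) z := by
  have hg1 : ContDiff ℝ 1 g := hg.of_le (by simp)
  have h := hc.hasFDerivAt_convolution_right (ContinuousLinearMap.mul ℝ ℝ) hf hg1 z
  rw [pConv_eq, h.fderiv, convolution_precompR_apply _ hf (hc.fderiv ℝ)
    (hg1.continuous_fderiv one_ne_zero)]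
  rfl

theorem tDeriv_pConv (hf : LocallyIntegrable f volume) (hg : ContDiff ℝ ∞ g)
    (hc : HasCompactSupport g) : tDeriv (pConv f g) = pConv f (tDeriv g) := by
  rw [tDeriv_eq_of_contDiff (contDiff_pConv hf hg hc), tDeriv_eq_of_contDiff hg]
  exact funext fun z => fderiv_pConv hf hg hc z _

theorem xDeriv_pConv (hf : LocallyIntegrable f volume) (hg : ContDiff ℝ ∞ g)
    (hc : HasCompactSupport g) (i : Fin N) : xDeriv i (pConv f g) = pConv f (xDeriv i g) := by
  rw [xDeriv_eq_of_contDiff (contDiff_pConv hf hg hc), xDeriv_eq_of_contDiff hg]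
  exact funext fun z => fderiv_pConv hf hg hc z _

theorem enorm_pConv_le {r : ℝ} {B : ℝ≥0∞}
    (hg : ∀ z, ‖g z‖ₑ ≤ (pQt N r 0).indicator (fun _ => B) z) (hB : B ≠ ⊤) (z : PSpace N) :
    ‖pConv f g z‖ₑ ≤ B * ∫⁻ w in pQt N r z, ‖f w‖ₑ := by
  calc ‖pConv f g z‖ₑ ≤ ∫⁻ w, ‖f w * g (z - w)‖ₑ := enorm_integral_le_lintegral_enorm _
    _ ≤ ∫⁻ w, (pQt N r z).indicator (fun w => B * ‖f w‖ₑ) w := by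
        refine lintegral_mono fun w => ?_
        rw [enorm_mul]
        have h1 := hg (z - w)
        have h2 : z - w ∈ pQt N r 0 ↔ w ∈ pQt N r z := by
          simp [mem_pQt, dist_eq_norm, norm_sub_rev, abs_sub_comm]
        by_cases h : w ∈ pQt N r z
        · rw [indicator_of_mem (h2.2 h)] at h1
          rw [indicator_of_mem h, mul_comm]
          gcongr
        · rw [indicator_of_notMem (mt h2.1 h)] at h1
          rw [indicator_of_notMem h, le_antisymm h1 zero_le, mul_zero]
    _ = _ := by
        rw [lintegral_indicator (measurableSet_pQt _ _ _), lintegral_const_mul' _ _ hB]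

theorem W21Dominated.pConv {r : ℝ} {B : ℝ≥0∞} (hf : LocallyIntegrable f volume)
    (hg : ContDiff ℝ ∞ g) (hc : HasCompactSupport g)
    (h : W21Dominated g ((pQt N r 0).indicator fun _ => B)) (hB : B ≠ ⊤) :
    W21Dominated (pConv f g) fun z => B * ∫⁻ w in pQt N r z, ‖f w‖ₑ where
  val z := enorm_pConv_le h.val hB z
  time z := by rw [tDeriv_pConv hf hg hc]; exact enorm_pConv_le h.time hB z
  space i z := by rw [xDeriv_pConv hf hg hc]; exact enorm_pConv_le (h.space i) hB z
  hess i j z := by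
    rw [xxDeriv, xDeriv_pConv hf hg hc,
      xDeriv_pConv hf (contDiff_xDeriv hg j) (hasCompactSupport_xDeriv hg hc j)]
    exact enorm_pConv_le (h.hess i j) hB z

end Convolution

section UpperBound

variable {N : ℕ}

theorem pDens_le (μ : Measure (PSpace N)) (ρ : ℝ) (z : PSpace N) :
    pDens μ ρ z ≤ (ENNReal.ofReal (ρ ^ N))⁻¹ * μ univ := by
  unfold pDens; gcongr; exact subset_univ _

theorem pDens_lt_top (μ : Measure (PSpace N)) [IsFiniteMeasure μ] {ρ : ℝ} (hρ : 0 < ρ) :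
    (ENNReal.ofReal (ρ ^ N))⁻¹ * μ univ < ⊤ :=
  ENNReal.mul_lt_top (by simpa using pow_pos hρ N) (measure_lt_top _ _)

theorem exists_isCompact_pDens_eq_zero {μ : Measure (PSpace N)} {K : Set (PSpace N)}
    (hK : IsCompact K) (hμ : μ Kᶜ = 0) (ρ : ℝ) :
    ∃ T, IsCompact T ∧ ∀ z ∉ T, pDens μ ρ z = 0 := by
  refine ⟨cthickening (max ρ (ρ ^ 2)) K, hK.cthickening, fun z hz => ?_⟩
  have : pQt N ρ z ⊆ Kᶜ := by
    intro w hw hwK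
    refine hz (mem_cthickening_of_dist_le z w _ K hwK ?_)
    rw [mem_pQt] at hw
    rw [Prod.dist_eq, dist_comm, dist_comm z.2, Real.dist_eq]
    exact max_le_max hw.1.le hw.2.le
  rw [pDens, measure_mono_null this hμ, mul_zero]

theorem lintegral_pDens_rpow_lt_top {μ : Measure (PSpace N)} [IsFiniteMeasure μ]
    {K : Set (PSpace N)} (hK : IsCompact K) (hμ : μ Kᶜ = 0) {ρ q : ℝ} (hρ : 0 < ρ) (hq : 0 < q) :
    ∫⁻ z, pDens μ ρ z ^ q < ⊤ := by
  obtain ⟨T, hT, h0⟩ := exists_isCompact_pDens_eq_zero hK hμ ρ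
  have hB := pDens_lt_top μ hρ
  calc ∫⁻ z, pDens μ ρ z ^ q
      ≤ ∫⁻ z, T.indicator (fun _ => ((ENNReal.ofReal (ρ ^ N))⁻¹ * μ univ) ^ q) z := by
        refine lintegral_mono fun z => ?_
        by_cases hz : z ∈ T
        · rw [indicator_of_mem hz]
          exact ENNReal.rpow_le_rpow (pDens_le μ ρ z) hq.le
        · simp [h0 z hz, hq]
    _ < ⊤ := by
        rw [lintegral_indicator hT.measurableSet, setLIntegral_const]
        exact ENNReal.mul_lt_top (ENNReal.rpow_lt_top_of_nonneg hq.le hB.ne) hT.measure_lt_top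

theorem pDens_le_of_mem {μ : Measure (PSpace N)} {ρ : ℝ} (hρ : 0 < ρ) {z w : PSpace N}
    (hw : w ∈ pQt N (2 * ρ) z) : pDens μ ρ w ≤ ENNReal.ofReal (3 ^ N) * pDens μ (3 * ρ) z := by
  have h1 : pQt N ρ w ⊆ pQt N (3 * ρ) z := by
    intro v hv
    have := mem_pQt_trans (by positivity) hρ.le hw hv
    convert this using 2; ring
  have h0 : ENNReal.ofReal (3 ^ N) ≠ 0 := by simp
  rw [pDens, pDens, mul_pow, ENNReal.ofReal_mul (by positivity),
    ENNReal.mul_inv (.inl h0) (.inl ENNReal.ofReal_ne_top), ← mul_assoc, ← mul_assoc,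
    ENNReal.mul_inv_cancel h0 ENNReal.ofReal_ne_top, one_mul]
  gcongr

/-- The smooth potential of `pDens μ ρ ^ (q - 1)` at scale `ρ`. -/
theorem exists_scale_test_function (N : ℕ) (ρ₀ : ℝ) {q : ℝ} (hq : 1 < q) :
    ∃ c : ℝ≥0∞, c ≠ ⊤ ∧ ∀ ρ, 0 < ρ → ρ ≤ ρ₀ → ∀ (μ : Measure (PSpace N)) [IsFiniteMeasure μ]
      (K : Set (PSpace N)), IsCompact K → μ Kᶜ = 0 →
      ∃ u : PSpace N → ℝ, ContDiff ℝ ∞ u ∧ HasCompactSupport u ∧ (∀ z, 0 ≤ u z) ∧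
        W21Dominated u (fun z => c * pDens μ (3 * ρ) z ^ (q - 1)) ∧
        ∫⁻ z, pDens μ ρ z ^ q ≤ ∫⁻ z, ENNReal.ofReal (u z) ∂μ := by
  obtain ⟨M, hM, hcut⟩ := exists_cutoff N ρ₀
  have hq1 : 0 < q - 1 := by linarith
  refine ⟨ENNReal.ofReal (M * 2 ^ (N + 2)) * pVol N * ENNReal.ofReal (3 ^ N) ^ (q - 1),
    ENNReal.mul_ne_top (ENNReal.mul_ne_top ENNReal.ofReal_ne_top (pVol_ne_top N))
      (ENNReal.rpow_ne_top_of_nonneg hq1.le ENNReal.ofReal_ne_top), ?_⟩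
  intro ρ hρ hρρ μ _ K hK hμ
  obtain ⟨g, hg, hgc, hg0, hg1, hgd⟩ := hcut ρ hρ hρρ
  set l : PSpace N → ℝ := fun z => (pDens μ ρ z ^ (q - 1)).toReal with hl
  have hpt : ∀ z, pDens μ ρ z ^ (q - 1) ≠ ⊤ := fun z =>
    ENNReal.rpow_ne_top_of_nonneg hq1.le ((pDens_le μ ρ z).trans_lt (pDens_lt_top μ hρ)).ne
  have hlof : ∀ z, ENNReal.ofReal (l z) = pDens μ ρ z ^ (q - 1) := fun z =>
    ENNReal.ofReal_toReal (hpt z)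
  have hl0 : ∀ z, 0 ≤ l z := fun z => ENNReal.toReal_nonneg
  have hlen : ∀ z, ‖l z‖ₑ = pDens μ ρ z ^ (q - 1) := fun z => by
    rw [Real.enorm_of_nonneg (hl0 z), hlof]
  have hlm : Measurable l := ((measurable_pDens μ ρ).pow_const _).ennreal_toReal
  obtain ⟨T, hT, hT0⟩ := exists_isCompact_pDens_eq_zero hK hμ ρ
  have hlc : HasCompactSupport l := by
    refine HasCompactSupport.intro hT fun z hz => ?_
    simp [hl, hT0 z hz, hq1]
  have hlint : LocallyIntegrable l volume := by
    refine (memLp_top_of_bound hlm.aestronglyMeasurable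
      (((ENNReal.ofReal (ρ ^ N))⁻¹ * μ univ) ^ (q - 1)).toReal
      (.of_forall fun z => ?_)).locallyIntegrable le_top
    rw [Real.norm_of_nonneg (hl0 z)]
    exact ENNReal.toReal_mono (ENNReal.rpow_ne_top_of_nonneg hq1.le (pDens_lt_top μ hρ).ne)
      (ENNReal.rpow_le_rpow (pDens_le μ ρ z) hq1.le)
  have hcd := contDiff_pConv hlint hg hgc
  have hρN : 0 < ρ ^ N := pow_pos hρ N
  refine ⟨fun z => (ρ ^ N)⁻¹ * pConv l g z, contDiff_const.mul hcd,
    (hasCompactSupport_pConv hlc hgc).mul_left, fun z => ?_, ?_, ?_⟩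
  · exact mul_nonneg (by positivity) (integral_nonneg fun w => mul_nonneg (hl0 w) (hg0 _))
  · refine ((W21Dominated.pConv hlint hg hgc hgd ENNReal.ofReal_ne_top).const_mul hcd _).mono
      fun z => ?_
    simp only [hlen]
    rw [Real.enorm_of_nonneg (by positivity), ← mul_assoc, ← ENNReal.ofReal_mul (by positivity)]
    calc ENNReal.ofReal ((ρ ^ N)⁻¹ * (M * (ρ ^ 2)⁻¹)) *
          ∫⁻ w in pQt N (2 * ρ) z, pDens μ ρ w ^ (q - 1)
        ≤ ENNReal.ofReal ((ρ ^ N)⁻¹ * (M * (ρ ^ 2)⁻¹)) *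
          ∫⁻ w in pQt N (2 * ρ) z, (ENNReal.ofReal (3 ^ N) * pDens μ (3 * ρ) z) ^ (q - 1) := by
          refine mul_le_mul_right ?_ _
          refine setLIntegral_mono_ae' (measurableSet_pQt _ _ _) (.of_forall fun w hw => ?_)
          exact ENNReal.rpow_le_rpow (pDens_le_of_mem hρ hw) hq1.le
      _ = _ := by
          rw [setLIntegral_const, volume_pQt (by positivity),
            ENNReal.mul_rpow_of_nonneg _ _ hq1.le]
          have : ENNReal.ofReal (M * 2 ^ (N + 2)) = ENNReal.ofReal ((ρ ^ N)⁻¹ * (M * (ρ ^ 2)⁻¹)) *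
              ENNReal.ofReal ((2 * ρ) ^ (N + 2)) := by
            rw [← ENNReal.ofReal_mul (by positivity)]
            congr 1; field_simp; ring
          rw [this]; ring
  · have hconv : ∀ z, ∫⁻ w in pQt N ρ z, pDens μ ρ w ^ (q - 1) ≤ ENNReal.ofReal (pConv l g z) := by
      intro z
      have hi : Integrable (fun w => l w * g (z - w)) volume :=
        hgc.convolutionExists_right (ContinuousLinearMap.mul ℝ ℝ) hlint hg.continuous z
      rw [pConv, ofReal_integral_eq_lintegral_ofReal hi
        (.of_forall fun w => mul_nonneg (hl0 w) (hg0 _)),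
        ← lintegral_indicator (measurableSet_pQt _ _ _)]
      refine lintegral_mono fun w => ?_
      by_cases h : w ∈ pQt N ρ z
      · have h2 : z - w ∈ pQt N ρ 0 := by
          simpa [mem_pQt, dist_eq_norm, norm_sub_rev, abs_sub_comm] using mem_pQt.1 h
        rw [indicator_of_mem h, hg1 _ h2, mul_one, hlof]
      · rw [indicator_of_notMem h]; exact zero_le
    calc ∫⁻ z, pDens μ ρ z ^ q
        = ∫⁻ w, pDens μ ρ w ^ (q - 1) *
            ∫⁻ _z in pQt N ρ w, ENNReal.ofReal ((ρ ^ N)⁻¹) ∂μ := by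
          refine lintegral_congr fun w => ?_
          rw [setLIntegral_const, ENNReal.ofReal_inv_of_pos hρN]
          change _ = _ * pDens μ ρ w
          nth_rw 3 [← ENNReal.rpow_one (pDens μ ρ w)]
          rw [← ENNReal.rpow_add_of_nonneg _ _ hq1.le zero_le_one]
          congr 1; ring
      _ = ∫⁻ z, ENNReal.ofReal ((ρ ^ N)⁻¹) * (∫⁻ w in pQt N ρ z, pDens μ ρ w ^ (q - 1)) ∂μ :=
          (lintegral_lintegral_pQt_swap ρ volume μ ((measurable_pDens μ ρ).pow_const _)
            measurable_const).symm
      _ ≤ _ := by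
          refine lintegral_mono fun z => ?_
          rw [ENNReal.ofReal_mul (by positivity)]
          gcongr
          exact hconv z

theorem ENNReal.le_rpow_of_le_mul_rpow {p q : ℝ} (hpq : p.HolderConjugate q) {W D : ℝ≥0∞}
    (hW : W ≠ ⊤) (h : W ≤ D * W ^ (1 / p)) : W ≤ D ^ q := by
  rcases eq_or_ne W 0 with rfl | h0
  · exact zero_le
  have hp := hpq.pos
  have hq := hpq.symm.pos
  have h1 : W ^ (1 / p) ≠ 0 := by simp [h0, hW]
  have h2 : W ^ (1 / p) ≠ ⊤ := ENNReal.rpow_ne_top_of_nonneg (by positivity) hW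
  have h3 : W ^ (1 / q) * W ^ (1 / p) = W := by
    rw [← ENNReal.rpow_add_of_nonneg _ _ (by positivity) (by positivity), one_div, one_div, add_comm,
      hpq.inv_add_inv_eq_one, ENNReal.rpow_one]
  have h4 : W ^ (1 / q) ≤ D := by
    rw [← ENNReal.mul_le_mul_iff_left h1 h2, h3]; exact h
  calc W = (W ^ (1 / q)) ^ q := by
        rw [← ENNReal.rpow_mul, one_div_mul_cancel hq.ne', ENNReal.rpow_one]
    _ ≤ D ^ q := ENNReal.rpow_le_rpow h4 hq.le

theorem ENNReal.sum_rpow_le_rpow_sum {ι : Type*} (s : Finset ι) (f : ι → ℝ≥0∞) {t : ℝ}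
    (ht : 1 ≤ t) : ∑ i ∈ s, f i ^ t ≤ (∑ i ∈ s, f i) ^ t := by
  classical
  induction s using Finset.induction_on with
  | empty => simp
  | insert a s ha ih =>
    rw [Finset.sum_insert ha, Finset.sum_insert ha]
    exact (add_le_add_right ih _).trans (ENNReal.add_rpow_le_rpow_add _ _ ht)

/-- If `μ` acts on test functions with norm at most `A`, then the dyadic `L^q` norm of the
potential of `μ` is controlled by `A`. -/
theorem exists_lintegral_tsum_pDens_le (N : ℕ) {ρ₀ p q : ℝ} (hρ₀ : 0 < ρ₀)
    (hpq : p.HolderConjugate q) :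
    ∃ C : ℝ≥0∞, C ≠ ⊤ ∧ ∀ (μ : Measure (PSpace N)) [IsFiniteMeasure μ] (K : Set (PSpace N)),
      IsCompact K → μ Kᶜ = 0 → ∀ A : ℝ≥0∞,
      (∀ φ : SchwartzMap (PSpace N) ℝ, ENNReal.ofReal (∫ z, φ z ∂μ) ≤
        A * ENNReal.ofReal (W21Norm N p fun z => φ z)) →
      ∫⁻ z, (∑' k : ℕ, pDens μ (ρ₀ / 2 ^ k) z) ^ q ≤ C * A ^ q := by
  have hq : 1 < q := hpq.symm.lt
  have hq0 : 0 < q := by linarith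
  have hp0 : 0 < p := hpq.pos
  set s := min 1 (q - 1) with hs
  have hs0 : 0 < s := lt_min one_pos (by linarith)
  have hs1 : s ≤ 1 := min_le_left _ _
  obtain ⟨c, hc, htest⟩ := exists_scale_test_function N ρ₀ hq
  obtain ⟨C₁, hC₁, hw⟩ := exists_lintegral_sum_pDens_le N hs0 hs1 hq
  set c₁ : ℝ≥0∞ := (N : ℝ≥0∞) ^ 2 + N + 2 with hc₁
  have hc₁t : c₁ ≠ ⊤ := by simp [c₁]
  set C₃ : ℝ≥0∞ := ENNReal.ofReal ((3 + 1) ^ (N + 2)) ^ q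
  have hC₃ : C₃ ≠ ⊤ := ENNReal.rpow_ne_top_of_nonneg hq0.le ENNReal.ofReal_ne_top
  refine ⟨C₁ * (c₁ * (c * (C₁ * C₃) ^ (1 / p))) ^ q, ?_, ?_⟩
  · exact ENNReal.mul_ne_top hC₁ (ENNReal.rpow_ne_top_of_nonneg hq0.le
      (ENNReal.mul_ne_top hc₁t (ENNReal.mul_ne_top hc (ENNReal.rpow_ne_top_of_nonneg
        (by positivity) (ENNReal.mul_ne_top hC₁ hC₃)))))
  intro μ _ K hK hμ A hA
  have hρ : ∀ k : ℕ, 0 < ρ₀ / 2 ^ k := fun k => by positivity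
  have hρρ : ∀ k : ℕ, ρ₀ / 2 ^ k ≤ ρ₀ := fun k => div_le_self hρ₀.le (one_le_pow₀ (by norm_num))
  have hpow : ∀ (n : ℕ) (a : ℕ → ℝ≥0∞) (t : ℝ), s ≤ t →
      ∑ k ∈ Finset.range n, a k ^ t ≤ (∑ k ∈ Finset.range n, a k ^ s) ^ (t / s) := by
    intro n a t hst
    refine le_trans (le_of_eq ?_) (ENNReal.sum_rpow_le_rpow_sum _ _ ((one_le_div hs0).2 hst))
    refine Finset.sum_congr rfl fun k _ => ?_
    rw [← ENNReal.rpow_mul, mul_div_cancel₀ _ hs0.ne']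
  choose u hu huc hu0 hud hui using fun k : ℕ => htest _ (hρ k) (hρρ k) μ K hK hμ
  have hmain : ∀ n : ℕ, ∑ k ∈ Finset.range n, ∫⁻ z, pDens μ (ρ₀ / 2 ^ k) z ^ q ≤
      (c₁ * (c * (C₁ * C₃) ^ (1 / p))) ^ q * A ^ q := by
    intro n
    set W := ∑ k ∈ Finset.range n, ∫⁻ z, pDens μ (ρ₀ / 2 ^ k) z ^ q with hW
    have hWt : W ≠ ⊤ := by
      refine (ENNReal.sum_lt_top.2 fun k _ => ?_).ne
      exact lintegral_pDens_rpow_lt_top hK hμ (hρ k) hq0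
    have hφs : ContDiff ℝ ∞ fun z => ∑ k ∈ Finset.range n, u k z := ContDiff.sum fun k _ => hu k
    have hφc : HasCompactSupport fun z => ∑ k ∈ Finset.range n, u k z := by
      refine HasCompactSupport.intro (K := ⋃ k ∈ Finset.range n, tsupport (u k))
        ((Finset.range n).isCompact_biUnion fun k _ => huc k) fun z hz => ?_
      refine Finset.sum_eq_zero fun k hk => ?_
      by_contra h
      exact hz (mem_biUnion hk (subset_tsupport _ h))
    have h1 := hA (hφc.toSchwartzMap hφs)
    have h2 : W ≤ ENNReal.ofReal (∫ z, ∑ k ∈ Finset.range n, u k z ∂μ) := by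
      rw [ofReal_integral_eq_lintegral_ofReal (hφs.continuous.integrable_of_hasCompactSupport hφc)
        (.of_forall fun z => Finset.sum_nonneg fun k _ => hu0 k z)]
      simp_rw [ENNReal.ofReal_sum_of_nonneg fun k (_ : k ∈ Finset.range n) => hu0 k _]
      rw [lintegral_finsetSum _ fun k _ => (hu k).continuous.measurable.ennreal_ofReal]
      exact Finset.sum_le_sum fun k _ => hui k
    have h3 := ((W21Dominated.sum (Finset.range n) hu hud).ofReal_W21Norm_le hp0)
    have h4 : ∫⁻ z, (∑ k ∈ Finset.range n, c * pDens μ (3 * (ρ₀ / 2 ^ k)) z ^ (q - 1)) ^ p ≤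
        c ^ p * (C₁ * C₃ * W) := by
      calc _ ≤ ∫⁻ z, c ^ p * (∑ k ∈ Finset.range n, pDens μ (3 * ρ₀ / 2 ^ k) z ^ s) ^ (q / s) := by
            refine lintegral_mono fun z => ?_
            rw [← Finset.mul_sum, ENNReal.mul_rpow_of_nonneg _ _ hp0.le]
            gcongr
            simp_rw [← mul_div_assoc]
            refine (ENNReal.rpow_le_rpow (hpow n _ (q - 1) (min_le_right _ _)) hp0.le).trans
              (le_of_eq ?_)
            rw [← ENNReal.rpow_mul, div_mul_eq_mul_div, hpq.symm.sub_one_mul_conj]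
        _ = c ^ p * ∫⁻ z, (∑ k ∈ Finset.range n, pDens μ (3 * ρ₀ / 2 ^ k) z ^ s) ^ (q / s) :=
            lintegral_const_mul' _ _ (ENNReal.rpow_ne_top_of_nonneg hp0.le hc)
        _ ≤ c ^ p * (C₁ * ∑ k ∈ Finset.range n, ∫⁻ z, pDens μ (3 * ρ₀ / 2 ^ k) z ^ q) := by
            gcongr; exact hw μ _ (by positivity) n
        _ ≤ c ^ p * (C₁ * ∑ k ∈ Finset.range n, C₃ * ∫⁻ z, pDens μ (ρ₀ / 2 ^ k) z ^ q) := by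
            gcongr with k
            rw [mul_div_assoc]
            exact lintegral_pDens_rpow_le hq.le (by norm_num) (hρ k) μ
        _ = _ := by rw [← Finset.mul_sum]; ring
    have h5 : W ≤ A * (c₁ * (c * (C₁ * C₃) ^ (1 / p))) * W ^ (1 / p) := by
      calc W ≤ A * (c₁ * (c ^ p * (C₁ * C₃ * W)) ^ (1 / p)) := by
            refine h2.trans (h1.trans ?_)
            gcongr
            refine h3.trans ?_
            gcongr
        _ = _ := by
            rw [ENNReal.mul_rpow_of_nonneg _ _ (by positivity),
              ENNReal.mul_rpow_of_nonneg _ W (by positivity), ← ENNReal.rpow_mul,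
              mul_one_div_cancel hp0.ne', ENNReal.rpow_one]
            ring
    have h6 := ENNReal.le_rpow_of_le_mul_rpow hpq hWt h5
    rwa [mul_comm A, ENNReal.mul_rpow_of_nonneg _ _ hq0.le] at h6
  have hn : ∀ n : ℕ, ∫⁻ z, (∑ k ∈ Finset.range n, pDens μ (ρ₀ / 2 ^ k) z) ^ q ≤
      C₁ * (c₁ * (c * (C₁ * C₃) ^ (1 / p))) ^ q * A ^ q := by
    intro n
    calc _ ≤ ∫⁻ z, (∑ k ∈ Finset.range n, pDens μ (ρ₀ / 2 ^ k) z ^ s) ^ (q / s) := by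
          refine lintegral_mono fun z => ?_
          have := hpow n (fun k => pDens μ (ρ₀ / 2 ^ k) z) 1 hs1
          simp only [ENNReal.rpow_one] at this
          refine (ENNReal.rpow_le_rpow this hq0.le).trans (le_of_eq ?_)
          rw [← ENNReal.rpow_mul, one_div, inv_mul_eq_div]
      _ ≤ _ := by
          rw [mul_assoc]
          exact (hw μ _ hρ₀ n).trans (mul_le_mul_right (hmain n) _)
  have hmono : ∀ z, Monotone fun n : ℕ => (∑ k ∈ Finset.range n, pDens μ (ρ₀ / 2 ^ k) z) ^ q :=
    fun z a b hab => ENNReal.rpow_le_rpow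
      (Finset.sum_le_sum_of_subset (Finset.range_mono hab)) hq0.le
  have hsup : ∀ z, (∑' k : ℕ, pDens μ (ρ₀ / 2 ^ k) z) ^ q =
      ⨆ n : ℕ, (∑ k ∈ Finset.range n, pDens μ (ρ₀ / 2 ^ k) z) ^ q := fun z =>
    tendsto_nhds_unique
      ((ENNReal.continuous_rpow_const.tendsto _).comp (ENNReal.tendsto_nat_tsum _))
      (tendsto_atTop_iSup (hmono z))
  simp_rw [hsup]
  rw [lintegral_iSup (fun n => (Finset.measurable_sum _ fun k _ =>
    measurable_pDens μ _).pow_const _) fun a b hab z => hmono z hab]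
  exact iSup_le hn

end UpperBound

theorem hasDerivAt_max_zero_sq (x : ℝ) :
    HasDerivAt (fun y : ℝ => max y 0 ^ 2) (2 * max x 0) x := by
  have hne : ∀ y : ℝ, y ≠ 0 → HasDerivAt (fun y : ℝ => max y 0 ^ 2) (2 * max y 0) y := by
    intro y hy
    rcases hy.lt_or_gt with h | h
    · rw [max_eq_right h.le, mul_zero]
      refine (hasDerivAt_const y (0 : ℝ)).congr_of_eventuallyEq ?_
      filter_upwards [gt_mem_nhds h] with z hz
      simp [max_eq_right (le_of_lt hz)]
    · rw [max_eq_left h.le]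
      have h2 : HasDerivAt (fun y : ℝ => y ^ 2) (2 * y) y := by simpa using hasDerivAt_pow 2 y
      refine h2.congr_of_eventuallyEq ?_
      filter_upwards [lt_mem_nhds h] with z hz
      simp [max_eq_left (le_of_lt hz)]
  rcases eq_or_ne x 0 with rfl | hx
  · exact hasDerivAt_of_hasDerivAt_of_ne hne (by fun_prop)
      (g := fun y => 2 * max y 0) (by fun_prop)
  · exact hne x hx

section Averaging

variable {N : ℕ}

/-- The parabolic dilation `(x, t) ↦ (ρ x, ρ² t)`. -/
noncomputable def pDil (N : ℕ) (ρ : ℝ) (z : PSpace N) : PSpace N := (ρ • z.1, ρ ^ 2 * z.2)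

/-- A continuous weight supported in the unit parabolic cylinder. -/
noncomputable def pKern (N : ℕ) (w : PSpace N) : ℝ :=
  max (1 - ‖w.1‖ ^ 2) 0 * max (1 - w.2 ^ 2) 0 ^ 2

/-- A potential whose spatial gradient is `x ↦ pKern x • x`. -/
noncomputable def pKernPot (N : ℕ) (w : PSpace N) : ℝ :=
  -(1 / 4) * (max (1 - ‖w.1‖ ^ 2) 0 ^ 2 * max (1 - w.2 ^ 2) 0 ^ 2)

theorem continuous_pKern : Continuous (pKern N) := by unfold pKern; fun_prop

theorem continuous_pKernPot : Continuous (pKernPot N) := by unfold pKernPot; fun_prop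

theorem pKern_nonneg (w : PSpace N) : 0 ≤ pKern N w := by unfold pKern; positivity

theorem mem_pQt_one {w : PSpace N} (h1 : 0 < 1 - ‖w.1‖ ^ 2) (h2 : 0 < 1 - w.2 ^ 2) :
    w ∈ pQt N 1 0 := by
  rw [mem_pQt]
  constructor
  · rw [Prod.fst_zero, dist_zero_right, ← abs_of_nonneg (norm_nonneg w.1), ← sq_lt_one_iff_abs_lt_one]
    linarith
  · rw [Prod.snd_zero, sub_zero, one_pow, ← sq_lt_one_iff_abs_lt_one]
    linarith

theorem pKern_eq_zero {w : PSpace N} (hw : w ∉ pQt N 1 0) : pKern N w = 0 := by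
  unfold pKern
  rcases le_or_gt (1 - ‖w.1‖ ^ 2) 0 with h | h
  · simp [max_eq_right h]
  · rcases le_or_gt (1 - w.2 ^ 2) 0 with h' | h'
    · simp [max_eq_right h']
    · exact absurd (mem_pQt_one h h') hw

theorem pKernPot_eq_zero {w : PSpace N} (hw : w ∉ pQt N 1 0) : pKernPot N w = 0 := by
  unfold pKernPot
  rcases le_or_gt (1 - ‖w.1‖ ^ 2) 0 with h | h
  · simp [max_eq_right h]
  · rcases le_or_gt (1 - w.2 ^ 2) 0 with h' | h'
    · simp [max_eq_right h']
    · exact absurd (mem_pQt_one h h') hw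

theorem pKern_le_one (w : PSpace N) : pKern N w ≤ 1 := by
  unfold pKern
  have h1 : max (1 - ‖w.1‖ ^ 2) 0 ≤ 1 := max_le (by nlinarith [sq_nonneg ‖w.1‖]) zero_le_one
  have h2 : max (1 - w.2 ^ 2) 0 ≤ 1 := max_le (by nlinarith [sq_nonneg w.2]) zero_le_one
  exact mul_le_one₀ h1 (by positivity) (pow_le_one₀ (by positivity) h2)

theorem abs_pKernPot_le_one (w : PSpace N) : |pKernPot N w| ≤ 1 := by
  unfold pKernPot
  have h1 : max (1 - ‖w.1‖ ^ 2) 0 ≤ 1 := max_le (by nlinarith [sq_nonneg ‖w.1‖]) zero_le_one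
  have h2 : max (1 - w.2 ^ 2) 0 ≤ 1 := max_le (by nlinarith [sq_nonneg w.2]) zero_le_one
  have h3 := mul_le_one₀ (pow_le_one₀ (n := 2) (by positivity) h1) (by positivity)
    (pow_le_one₀ (n := 2) (by positivity) h2)
  have h4 : 0 ≤ max (1 - ‖w.1‖ ^ 2) 0 ^ 2 * max (1 - w.2 ^ 2) 0 ^ 2 := by positivity
  rw [abs_le]; constructor <;> linarith

theorem pQt_one_subset_closedBall : pQt N 1 0 ⊆ closedBall (0 : PSpace N) 1 := by
  intro w hw
  rw [mem_pQt, one_pow] at hw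
  rw [mem_closedBall, Prod.dist_eq, Real.dist_eq]
  exact max_le hw.1.le hw.2.le

theorem hasCompactSupport_pKern : HasCompactSupport (pKern N) :=
  HasCompactSupport.intro (isCompact_closedBall (0 : PSpace N) 1) fun _ hw =>
    pKern_eq_zero fun h => hw (pQt_one_subset_closedBall h)

theorem hasCompactSupport_pKernPot : HasCompactSupport (pKernPot N) :=
  HasCompactSupport.intro (isCompact_closedBall (0 : PSpace N) 1) fun _ hw =>
    pKernPot_eq_zero fun h => hw (pQt_one_subset_closedBall h)

theorem integral_pKern_pos : 0 < ∫ w, pKern N w := by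
  refine continuous_pKern.integral_pos_of_hasCompactSupport_nonneg_nonzero
    hasCompactSupport_pKern (fun w => pKern_nonneg w) (x := 0) ?_
  simp [pKern]

theorem differentiable_pKernPot : Differentiable ℝ (pKernPot N) := by
  have hm : Differentiable ℝ fun y : ℝ => max y 0 ^ 2 :=
    fun x => (hasDerivAt_max_zero_sq x).differentiableAt
  have h1 : Differentiable ℝ fun w : PSpace N => 1 - ‖w.1‖ ^ 2 :=
    (differentiable_const _).sub (differentiable_fst.norm_sq ℝ)
  have h2 : Differentiable ℝ fun w : PSpace N => 1 - w.2 ^ 2 := by fun_prop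
  exact ((hm.comp h1).mul (hm.comp h2)).const_mul _

theorem xDeriv_pKernPot (i : Fin N) (w : PSpace N) :
    xDeriv i (pKernPot N) w = pKern N w * w.1 i := by
  have h1 : HasDerivAt (fun t : ℝ => w.1 + t • EuclideanSpace.single i (1 : ℝ))
      (EuclideanSpace.single i (1 : ℝ)) 0 := by
    simpa using ((hasDerivAt_id (0 : ℝ)).smul_const (EuclideanSpace.single i (1 : ℝ))).const_add w.1
  have h2 := h1.norm_sq.const_sub 1
  have h3 := (hasDerivAt_max_zero_sq _).comp (0 : ℝ) h2
  have h4 := ((h3.mul_const (max (1 - w.2 ^ 2) 0 ^ 2)).const_mul (-(1 / 4) : ℝ)).deriv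
  simp only [Function.comp_def, zero_smul, add_zero] at h4
  rw [xDeriv, lineDeriv]
  refine h4.trans ?_
  rw [pKern, EuclideanSpace.inner_single_right]
  simp
  ring

theorem continuous_pDil_uncurry : Continuous fun x : ℝ × PSpace N => pDil N x.1 x.2 := by
  unfold pDil; fun_prop

theorem continuous_pDil (ρ : ℝ) : Continuous (pDil N ρ) := by unfold pDil; fun_prop

theorem contDiff_pDil (ρ : ℝ) : ContDiff ℝ ∞ (pDil N ρ) := by unfold pDil; fun_prop

theorem pScale_inv (ρ : ℝ) : pScale N ρ⁻¹ = pDil N ρ := by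
  funext z; simp [pScale, pDil]

/-- Integration by parts moving one spatial derivative onto the kernel potential. -/
theorem integral_pKern_mul_xDeriv {f : PSpace N → ℝ} (hf : ContDiff ℝ ∞ f) (ρ : ℝ) (i : Fin N) :
    ∫ w, pKern N w * w.1 i * xDeriv i f (pDil N ρ w) =
      -(ρ * ∫ w, pKernPot N w * xxDeriv i i f (pDil N ρ w)) := by
  have hg : ContDiff ℝ ∞ fun w => xDeriv i f (pDil N ρ w) :=
    (contDiff_xDeriv hf i).comp (contDiff_pDil ρ)
  have e1 : ∀ w, fderiv ℝ (pKernPot N) w (EuclideanSpace.single i 1, 0) = pKern N w * w.1 i :=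
    fun w => by rw [← xDeriv_eq_fderiv (differentiable_pKernPot w), xDeriv_pKernPot]
  have e2 : ∀ w, fderiv ℝ (fun w => xDeriv i f (pDil N ρ w)) w (EuclideanSpace.single i 1, 0) =
      ρ * xxDeriv i i f (pDil N ρ w) := fun w => by
    rw [← xDeriv_eq_fderiv (hg.differentiable (by simp) w), ← pScale_inv,
      xDeriv_comp_pScale (xDeriv i f), inv_inv]
    rfl
  have hk : HasCompactSupport fun w : PSpace N => pKern N w * w.1 i :=
    hasCompactSupport_pKern.mul_right
  have hc1 : Continuous fun w : PSpace N => pKern N w * w.1 i :=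
    continuous_pKern.mul (by fun_prop)
  have hc2 : Continuous fun w => ρ * xxDeriv i i f (pDil N ρ w) :=
    continuous_const.mul ((contDiff_xxDeriv hf i i).continuous.comp (continuous_pDil ρ))
  have := integral_mul_fderiv_eq_neg_fderiv_mul_of_integrable (μ := volume)
    (f := pKernPot N) (g := fun w => xDeriv i f (pDil N ρ w)) (v := (EuclideanSpace.single i 1, 0))
    (by simp_rw [e1]
        exact (hc1.mul hg.continuous).integrable_of_hasCompactSupport hk.mul_right)
    (by simp_rw [e2]
        exact (continuous_pKernPot.mul hc2).integrable_of_hasCompactSupport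
          hasCompactSupport_pKernPot.mul_right)
    ((continuous_pKernPot.mul hg.continuous).integrable_of_hasCompactSupport
      hasCompactSupport_pKernPot.mul_right)
    (fun w _ => differentiable_pKernPot w) (fun w _ => hg.differentiable (by simp) w)
  simp_rw [e1, e2] at this
  rw [← neg_eq_iff_eq_neg] at this
  rw [← this, ← integral_const_mul]
  congr 2
  funext w; ring

/-- The quantity controlling the oscillation of a function on parabolic cylinders. -/
noncomputable def pGrad (f : PSpace N → ℝ) (z : PSpace N) : ℝ≥0∞ :=
  ‖f z‖ₑ + ‖tDeriv f z‖ₑ + ∑ i, ‖xxDeriv i i f z‖ₑ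

theorem measurable_pGrad {f : PSpace N → ℝ} (hf : ContDiff ℝ ∞ f) : Measurable (pGrad f) := by
  unfold pGrad
  exact ((hf.continuous.measurable.enorm).add (contDiff_tDeriv hf).continuous.measurable.enorm).add
    (Finset.measurable_sum _ fun i _ => (contDiff_xxDeriv hf i i).continuous.measurable.enorm)

/-- The radial derivative along parabolic dilations. -/
noncomputable def pRad (f : PSpace N → ℝ) (ρ : ℝ) (w : PSpace N) : ℝ :=
  fderiv ℝ f (pDil N ρ w) (w.1, 2 * ρ * w.2)

theorem hasDerivAt_pDil {f : PSpace N → ℝ} (hf : ContDiff ℝ ∞ f) (ρ : ℝ) (w : PSpace N) :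
    HasDerivAt (fun r => f (pDil N r w)) (pRad f ρ w) ρ := by
  have h : HasDerivAt (fun r => pDil N r w) (w.1, 2 * ρ * w.2) ρ := by
    refine HasDerivAt.prodMk ?_ ?_
    · simpa using (hasDerivAt_id ρ).smul_const w.1
    · simpa using (hasDerivAt_pow 2 ρ).mul_const w.2
  exact (hf.differentiable (by simp) _).hasFDerivAt.comp_hasDerivAt ρ h

theorem continuous_pRad {f : PSpace N → ℝ} (hf : ContDiff ℝ ∞ f) :
    Continuous fun x : ℝ × PSpace N => pRad f x.1 x.2 := by
  unfold pRad
  exact ((hf.continuous_fderiv (by simp)).comp continuous_pDil_uncurry).clm_apply (by fun_prop)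

theorem pRad_eq {f : PSpace N → ℝ} (hf : ContDiff ℝ ∞ f) (ρ : ℝ) (w : PSpace N) :
    pRad f ρ w = ∑ i, w.1 i * xDeriv i f (pDil N ρ w) + 2 * ρ * w.2 * tDeriv f (pDil N ρ w) := by
  have hw : ((w.1, 2 * ρ * w.2) : PSpace N) =
      ∑ i, w.1 i • ((EuclideanSpace.single i 1, 0) : PSpace N) + (2 * ρ * w.2) • (0, 1) := by
    refine Prod.ext ?_ ?_
    · have := (EuclideanSpace.basisFun (Fin N) ℝ).sum_repr w.1
      simpa [Prod.fst_sum] using this.symm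
    · simp [Prod.snd_sum]
  have hd := hf.differentiable (by simp) (pDil N ρ w)
  rw [pRad, hw, map_add, map_sum, tDeriv_eq_fderiv hd]
  simp_rw [xDeriv_eq_fderiv hd, map_smul, smul_eq_mul]

theorem enorm_integral_pRad_le {f : PSpace N → ℝ} (hf : ContDiff ℝ ∞ f) {ρ : ℝ} (hρ : 0 ≤ ρ) :
    ‖∫ w, pKern N w * pRad f ρ w‖ₑ ≤
      ENNReal.ofReal (2 * ρ) * ∫⁻ w in pQt N 1 0, pGrad f (pDil N ρ w) := by
  have hcomp : ∀ {h : PSpace N → ℝ}, Continuous h → Continuous fun w => h (pDil N ρ w) :=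
    fun hh => hh.comp (continuous_pDil ρ)
  have hi1 : ∀ i, Integrable fun w => pKern N w * w.1 i * xDeriv i f (pDil N ρ w) := fun i =>
    ((continuous_pKern.mul (by fun_prop)).mul
      (hcomp (contDiff_xDeriv hf i).continuous)).integrable_of_hasCompactSupport
      (hasCompactSupport_pKern.mul_right.mul_right)
  have hi2 : Integrable fun w => pKern N w * w.2 * tDeriv f (pDil N ρ w) :=
    ((continuous_pKern.mul (by fun_prop)).mul
      (hcomp (contDiff_tDeriv hf).continuous)).integrable_of_hasCompactSupport
      (hasCompactSupport_pKern.mul_right.mul_right)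
  have e : ∫ w, pKern N w * pRad f ρ w =
      ∑ i, -(ρ * ∫ w, pKernPot N w * xxDeriv i i f (pDil N ρ w)) +
        2 * ρ * ∫ w, pKern N w * w.2 * tDeriv f (pDil N ρ w) := by
    simp_rw [← integral_pKern_mul_xDeriv hf]
    rw [← integral_finsetSum _ fun i _ => hi1 i, ← integral_const_mul,
      ← integral_add (integrable_finsetSum _ fun i _ => hi1 i) (hi2.const_mul _)]
    congr 1; funext w
    rw [pRad_eq hf, mul_add, Finset.mul_sum]
    congr 1
    · exact Finset.sum_congr rfl fun i _ => by ring
    · ring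
  have b : ∀ (k h : PSpace N → ℝ), (∀ w, |k w| ≤ 1) → (∀ w ∉ pQt N 1 0, k w = 0) →
      ‖∫ w, k w * h w‖ₑ ≤ ∫⁻ w in pQt N 1 0, ‖h w‖ₑ := by
    intro k h hk1 hk0
    refine (enorm_integral_le_lintegral_enorm _).trans ?_
    rw [← lintegral_indicator (measurableSet_pQt _ _ _)]
    refine lintegral_mono fun w => ?_
    by_cases hw : w ∈ pQt N 1 0
    · rw [indicator_of_mem hw, enorm_mul]
      refine mul_le_of_le_one_left zero_le ?_
      rw [Real.enorm_eq_ofReal_abs]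
      exact ENNReal.ofReal_le_one.2 (hk1 w)
    · simp [hk0 w hw]
  have hm : ∀ {h : PSpace N → ℝ}, Continuous h → Measurable fun w => ‖h (pDil N ρ w)‖ₑ :=
    fun hh => (hcomp hh).measurable.enorm
  rw [e]
  calc _ ≤ (∑ i, ENNReal.ofReal (2 * ρ) * ∫⁻ w in pQt N 1 0, ‖xxDeriv i i f (pDil N ρ w)‖ₑ) +
        ENNReal.ofReal (2 * ρ) * ∫⁻ w in pQt N 1 0, ‖tDeriv f (pDil N ρ w)‖ₑ := by
        refine (enorm_add_le _ _).trans (add_le_add ((enorm_sum_le _ _).trans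
          (Finset.sum_le_sum fun i _ => ?_)) ?_)
        · rw [enorm_neg, enorm_mul, Real.enorm_of_nonneg hρ]
          refine mul_le_mul' (ENNReal.ofReal_le_ofReal (by linarith)) ?_
          exact b _ _ abs_pKernPot_le_one fun w hw => pKernPot_eq_zero hw
        · rw [enorm_mul, Real.enorm_of_nonneg (by positivity)]
          refine mul_le_mul_right ?_ _
          refine b (fun w => pKern N w * w.2) _ (fun w => ?_) fun w hw => by
            simp [pKern_eq_zero hw]
          by_cases hw : w ∈ pQt N 1 0
          · rw [abs_mul, abs_of_nonneg (pKern_nonneg w)]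
            have h2 := (mem_pQt.1 hw).2
            rw [one_pow, Prod.snd_zero, sub_zero] at h2
            exact mul_le_one₀ (pKern_le_one w) (abs_nonneg _) h2.le
          · simp [pKern_eq_zero hw]
    _ ≤ _ := by
        rw [← Finset.mul_sum, ← mul_add]
        refine mul_le_mul_right ?_ _
        rw [← lintegral_finsetSum _ fun i _ => hm (contDiff_xxDeriv hf i i).continuous,
          ← lintegral_add_right _ (hm (contDiff_tDeriv hf).continuous)]
        refine lintegral_mono fun w => ?_
        rw [pGrad, add_comm (∑ i, _), add_assoc]
        exact le_add_left le_rfl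

theorem pKern_mul_enorm_le {f : PSpace N → ℝ} (hf : ContDiff ℝ ∞ f) {a : ℝ} (ha : 0 ≤ a) :
    ENNReal.ofReal (∫ w, pKern N w) * ‖f 0‖ₑ ≤ (∫⁻ w in pQt N 1 0, pGrad f (pDil N a w)) +
      ∫⁻ ρ in Ioc 0 a, ENNReal.ofReal (2 * ρ) * ∫⁻ w in pQt N 1 0, pGrad f (pDil N ρ w) := by
  have hc : Continuous fun x : ℝ × PSpace N => pKern N x.2 * pRad f x.1 x.2 :=
    (continuous_pKern.comp continuous_snd).mul (continuous_pRad hf)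
  have hftc : ∀ w, ∫ ρ in Ioc 0 a, pRad f ρ w = f (pDil N a w) - f 0 := fun w => by
    rw [← intervalIntegral.integral_of_le ha,
      intervalIntegral.integral_eq_sub_of_hasDerivAt (fun ρ _ => hasDerivAt_pDil hf ρ w)
        (((continuous_pRad hf).comp (Continuous.prodMk_left w)).intervalIntegrable _ _)]
    congr 2
    simp [pDil]
  have hint : Integrable (fun x : ℝ × PSpace N => pKern N x.2 * pRad f x.1 x.2)
      ((volume.restrict (Ioc 0 a)).prod volume) := by
    rw [← Measure.restrict_univ (μ := (volume : Measure (PSpace N))), Measure.prod_restrict]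
    have hK : IsCompact (Icc 0 a ×ˢ closedBall (0 : PSpace N) 1) :=
      isCompact_Icc.prod (isCompact_closedBall _ _)
    refine (hc.continuousOn.integrableOn_compact hK).of_forall_sdiff_eq_zero
      (measurableSet_Ioc.prod MeasurableSet.univ) fun x hx => ?_
    have : x.2 ∉ pQt N 1 0 := fun h => hx.2 ⟨Ioc_subset_Icc_self hx.1.1, pQt_one_subset_closedBall h⟩
    simp [pKern_eq_zero this]
  have hswap := integral_integral_swap (f := fun ρ w => pKern N w * pRad f ρ w) hint
  have hi1 : Integrable fun w => pKern N w * f (pDil N a w) :=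
    (continuous_pKern.mul (hf.continuous.comp
      (continuous_pDil a))).integrable_of_hasCompactSupport hasCompactSupport_pKern.mul_right
  have hi2 : Integrable fun w => pKern N w * f 0 :=
    (continuous_pKern.integrable_of_hasCompactSupport hasCompactSupport_pKern).mul_const _
  have e : (∫ w, pKern N w) * f 0 = (∫ w, pKern N w * f (pDil N a w)) -
      ∫ ρ in Ioc 0 a, ∫ w, pKern N w * pRad f ρ w := by
    rw [hswap]
    simp_rw [integral_const_mul, hftc, mul_sub]
    rw [integral_sub hi1 hi2, integral_mul_const]
    ring
  rw [← Real.enorm_of_nonneg integral_pKern_pos.le, ← enorm_mul, e]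
  refine (enorm_sub_le).trans (add_le_add ?_ ?_)
  · refine (enorm_integral_le_lintegral_enorm _).trans ?_
    rw [← lintegral_indicator (measurableSet_pQt _ _ _)]
    refine lintegral_mono fun w => ?_
    by_cases hw : w ∈ pQt N 1 0
    · rw [indicator_of_mem hw, enorm_mul]
      refine (mul_le_of_le_one_left zero_le ?_).trans (le_add_right (le_add_right le_rfl))
      rw [Real.enorm_of_nonneg (pKern_nonneg w)]
      exact ENNReal.ofReal_le_one.2 (pKern_le_one w)
    · simp [pKern_eq_zero hw]
  · refine (enorm_integral_le_lintegral_enorm _).trans ?_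
    exact setLIntegral_mono' measurableSet_Ioc fun ρ hρ => enorm_integral_pRad_le hf hρ.1.le

end Averaging

section Representation

variable {N : ℕ}

theorem map_pDil_volume {ρ : ℝ} (hρ : 0 < ρ) :
    Measure.map (pDil N ρ) volume =
      (ENNReal.ofReal (ρ ^ (N + 2)))⁻¹ • (volume : Measure (PSpace N)) := by
  have h1 : Measure.map (fun x : EuclideanSpace ℝ (Fin N) => ρ • x) volume =
      (ENNReal.ofReal (ρ ^ N))⁻¹ • volume := by
    rw [Measure.map_addHaar_smul _ hρ.ne', finrank_euclideanSpace_fin, abs_of_nonneg (by positivity),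
      ENNReal.ofReal_inv_of_pos (by positivity)]
  have h2 : Measure.map (fun x : ℝ => ρ ^ 2 * x) volume =
      (ENNReal.ofReal (ρ ^ 2))⁻¹ • volume := by
    rw [← ENNReal.ofReal_inv_of_pos (by positivity), ← abs_of_nonneg (a := (ρ ^ 2)⁻¹) (by positivity)]
    exact Real.map_volume_mul_left (by positivity)
  have h3 := Measure.map_prod_map (volume : Measure (EuclideanSpace ℝ (Fin N))) (volume : Measure ℝ)
    (f := fun x => ρ • x) (g := fun x => ρ ^ 2 * x) (by fun_prop) (by fun_prop)
  rw [Measure.volume_eq_prod]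
  change Measure.map (Prod.map _ _) _ = _
  rw [← h3, h1, h2, Measure.prod_smul_left, Measure.prod_smul_right, smul_smul, pow_add,
    ENNReal.ofReal_mul (by positivity), ENNReal.mul_inv (by simp [hρ]) (by simp)]

theorem setLIntegral_pDil {ρ : ℝ} (hρ : 0 < ρ) {h : PSpace N → ℝ≥0∞} (hh : Measurable h) :
    ∫⁻ w in pQt N 1 0, h (pDil N ρ w) =
      (ENNReal.ofReal (ρ ^ (N + 2)))⁻¹ * ∫⁻ w in pQt N ρ 0, h w := by
  have hm := measurableSet_pQt N ρ 0
  rw [← lintegral_indicator hm, ← smul_eq_mul, ← lintegral_smul_measure, ← map_pDil_volume hρ,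
    lintegral_map (hh.indicator hm) (continuous_pDil ρ).measurable,
    ← lintegral_indicator (measurableSet_pQt N 1 0)]
  refine lintegral_congr fun w => ?_
  have hiff : pDil N ρ w ∈ pQt N ρ 0 ↔ w ∈ pQt N 1 0 := by
    rw [← pScale_inv, pScale_mem_pQt (inv_pos.2 hρ), mul_inv_cancel₀ hρ.ne']
  by_cases hw : w ∈ pQt N 1 0
  · rw [indicator_of_mem hw, indicator_of_mem (hiff.2 hw)]
  · rw [indicator_of_notMem hw, indicator_of_notMem (mt hiff.1 hw)]

theorem setLIntegral_pQt_add (ρ : ℝ) (z : PSpace N) (h : PSpace N → ℝ≥0∞) :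
    ∫⁻ w in pQt N ρ 0, h (z + w) = ∫⁻ w in pQt N ρ z, h w := by
  rw [← lintegral_indicator (measurableSet_pQt N ρ z),
    ← lintegral_add_left_eq_self (μ := volume) _ z, ← lintegral_indicator (measurableSet_pQt N ρ 0)]
  refine lintegral_congr fun w => ?_
  have hiff : z + w ∈ pQt N ρ z ↔ w ∈ pQt N ρ 0 := by
    simp [mem_pQt, dist_eq_norm]
  by_cases hw : w ∈ pQt N ρ 0
  · rw [indicator_of_mem hw, indicator_of_mem (hiff.2 hw)]
  · rw [indicator_of_notMem hw, indicator_of_notMem (mt hiff.1 hw)]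

theorem tDeriv_comp_add_left (f : PSpace N → ℝ) (z w : PSpace N) :
    tDeriv (fun v => f (z + v)) w = tDeriv f (z + w) := by
  simp only [tDeriv]
  exact deriv_comp_const_add (fun s => f (z.1 + w.1, s)) z.2 w.2

theorem xDeriv_comp_add_left (i : Fin N) (f : PSpace N → ℝ) (z w : PSpace N) :
    xDeriv i (fun v => f (z + v)) w = xDeriv i f (z + w) := by
  simp only [xDeriv, lineDeriv, add_assoc, Prod.add_def]

theorem pGrad_comp_add_left (f : PSpace N → ℝ) (z w : PSpace N) :
    pGrad (fun v => f (z + v)) w = pGrad f (z + w) := by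
  have h : ∀ i, xDeriv i (fun v => f (z + v)) = fun v => xDeriv i f (z + v) :=
    fun i => funext (xDeriv_comp_add_left i f z)
  simp only [pGrad, tDeriv_comp_add_left, xxDeriv, h, xDeriv_comp_add_left]

theorem pKern_mul_enorm_le_setLIntegral {f : PSpace N → ℝ} (hf : ContDiff ℝ ∞ f) (z : PSpace N)
    {a : ℝ} (ha : 0 < a) :
    ENNReal.ofReal (∫ w, pKern N w) * ‖f z‖ₑ ≤
      (ENNReal.ofReal (a ^ (N + 2)))⁻¹ * (∫⁻ w in pQt N a z, pGrad f w) +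
      2 * ∫⁻ ρ in Ioc 0 a, (∫⁻ w in pQt N ρ z, pGrad f w) / ENNReal.ofReal (ρ ^ (N + 1)) := by
  have hft : ContDiff ℝ ∞ fun v => f (z + v) := hf.comp (contDiff_const.add contDiff_id)
  have hm : Measurable fun w => pGrad f (z + w) :=
    (measurable_pGrad hf).comp (measurable_const_add z)
  have h := pKern_mul_enorm_le hft ha.le
  simp only [add_zero, pGrad_comp_add_left] at h
  refine h.trans (add_le_add (le_of_eq ?_) ?_)
  · rw [setLIntegral_pDil ha hm, setLIntegral_pQt_add a z (pGrad f)]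
  · rw [← lintegral_const_mul' _ _ (by norm_num)]
    refine setLIntegral_mono' measurableSet_Ioc fun ρ hρ => le_of_eq ?_
    have hρ0 : 0 < ρ := hρ.1
    rw [setLIntegral_pDil hρ0 hm, setLIntegral_pQt_add ρ z (pGrad f), pow_succ ρ (N + 1),
      ENNReal.ofReal_mul (p := ρ ^ (N + 1)) (by positivity), ENNReal.mul_inv (by simp [hρ0]) (by simp),
      ENNReal.ofReal_mul (by norm_num), ENNReal.ofReal_ofNat, div_eq_mul_inv]
    have : ENNReal.ofReal ρ * (ENNReal.ofReal ρ)⁻¹ = 1 :=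
      ENNReal.mul_inv_cancel (by simpa using hρ0) (by simp)
    calc _ = 2 * (ENNReal.ofReal ρ * (ENNReal.ofReal ρ)⁻¹) * (ENNReal.ofReal (ρ ^ (N + 1)))⁻¹ *
          ∫⁻ w in pQt N ρ z, pGrad f w := by ring
      _ = _ := by rw [this]; ring

/-- The Riesz potential of a function restricted to scales below `R`. -/
noncomputable def pPot (f : PSpace N → ℝ≥0∞) (R : ℝ) (z : PSpace N) : ℝ≥0∞ :=
  ∫⁻ ρ in Ioo 0 R, (∫⁻ w in pQt N ρ z, f w) / ENNReal.ofReal (ρ ^ (N + 1))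

theorem exists_enorm_le_pPot (N : ℕ) {R : ℝ} (hR : 0 < R) :
    ∃ C : ℝ≥0∞, C ≠ ⊤ ∧ ∀ f : PSpace N → ℝ, ContDiff ℝ ∞ f → ∀ z,
      ‖f z‖ₑ ≤ C * pPot (pGrad f) (2 * R) z := by
  set κ := ENNReal.ofReal (∫ w, pKern N w) with hκ
  have hκ0 : κ ≠ 0 := by simpa [hκ] using integral_pKern_pos (N := N)
  have hR0 : ENNReal.ofReal R ≠ 0 := by simpa using hR
  refine ⟨(ENNReal.ofReal R * κ)⁻¹ * ((ENNReal.ofReal R)⁻¹ + 2 * ENNReal.ofReal R), ?_, ?_⟩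
  · refine ENNReal.mul_ne_top (ENNReal.inv_ne_top.2 (mul_ne_zero hR0 hκ0)) ?_
    exact ENNReal.add_ne_top.2 ⟨ENNReal.inv_ne_top.2 hR0, by finiteness⟩
  intro f hf z
  set T := pPot (pGrad f) (2 * R) z with hT
  set G : ℝ → ℝ≥0∞ := fun ρ => (∫⁻ w in pQt N ρ z, pGrad f w) / ENNReal.ofReal (ρ ^ (N + 1))
  have key : ∀ a ∈ Ioo R (2 * R), κ * ‖f z‖ₑ ≤ (ENNReal.ofReal R)⁻¹ * G a + 2 * T := by
    intro a ha
    have ha0 : 0 < a := hR.trans ha.1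
    refine (pKern_mul_enorm_le_setLIntegral hf z ha0).trans (add_le_add ?_ ?_)
    · rw [pow_succ, ENNReal.ofReal_mul (by positivity), ENNReal.mul_inv (by simp [ha0]) (by simp)]
      calc _ = (ENNReal.ofReal a)⁻¹ * G a := by simp only [G, div_eq_mul_inv]; ring
        _ ≤ _ := by
          gcongr
          exact ha.1.le
    · refine mul_le_mul_right (lintegral_mono_set (Ioc_subset_Ioo_right ha.2)) _
  have hint : ENNReal.ofReal R * κ * ‖f z‖ₑ ≤
      ((ENNReal.ofReal R)⁻¹ + 2 * ENNReal.ofReal R) * T := by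
    have hv : volume (Ioo R (2 * R)) = ENNReal.ofReal R := by
      rw [Real.volume_Ioo]; congr 1; ring
    calc _ = ∫⁻ a in Ioo R (2 * R), κ * ‖f z‖ₑ := by
          rw [setLIntegral_const, hv]; ring
      _ ≤ ∫⁻ a in Ioo R (2 * R), ((ENNReal.ofReal R)⁻¹ * G a + 2 * T) :=
          setLIntegral_mono' measurableSet_Ioo key
      _ = (∫⁻ a in Ioo R (2 * R), (ENNReal.ofReal R)⁻¹ * G a) + 2 * T * ENNReal.ofReal R := by
          rw [lintegral_add_right _ measurable_const, setLIntegral_const, hv]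
      _ ≤ (ENNReal.ofReal R)⁻¹ * T + 2 * T * ENNReal.ofReal R := by
          rw [lintegral_const_mul' _ _ (ENNReal.inv_ne_top.2 hR0)]
          gcongr
          exact lintegral_mono_set (Ioo_subset_Ioo hR.le le_rfl)
      _ = _ := by ring
  rw [mul_assoc]
  exact (ENNReal.mul_le_iff_le_inv (mul_ne_zero hR0 hκ0) (by finiteness)).1 hint

theorem measurable_measure_pQt_prod (μ : Measure (PSpace N)) [SFinite μ] :
    Measurable fun x : PSpace N × ℝ => μ (pQt N x.2 x.1) := by
  have h : Measurable fun x : PSpace N × ℝ => ((x.2, x.1) : ℝ × PSpace N) := by fun_prop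
  have h' := (measurable_measure_pQt_uncurry μ).comp h
  simpa only [Function.comp_def] using h'

theorem measurable_pPot_kernel (f : PSpace N → ℝ≥0∞) :
    Measurable fun x : PSpace N × ℝ =>
      (∫⁻ w in pQt N x.2 x.1, f w) / ENNReal.ofReal (x.2 ^ (N + 1)) := by
  have h : ∀ x : PSpace N × ℝ, ∫⁻ w in pQt N x.2 x.1, f w =
      (volume.withDensity f) (pQt N x.2 x.1) := fun x =>
    (withDensity_apply f (measurableSet_pQt N x.2 x.1)).symm
  simp_rw [h]
  refine Measurable.div ?_ (by fun_prop)
  exact measurable_measure_pQt_prod _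

theorem measurable_riesz (R : ℝ) (μ : Measure (PSpace N)) [SFinite μ] :
    Measurable (riesz N R μ) := by
  have h : Measurable fun x : PSpace N × ℝ =>
      μ (pQt N x.2 x.1) / ENNReal.ofReal (x.2 ^ (N + 1)) :=
    Measurable.div (measurable_measure_pQt_prod μ)
      (ENNReal.measurable_ofReal.comp (measurable_snd.pow_const _))
  exact h.lintegral_prod_right' (ν := volume.restrict (Ioo 0 R))

/-- Symmetry of the Riesz potential. -/
theorem lintegral_pPot (R : ℝ) (μ : Measure (PSpace N)) [SFinite μ] {f : PSpace N → ℝ≥0∞}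
    (hf : Measurable f) :
    ∫⁻ z, pPot f R z ∂μ = ∫⁻ w, f w * riesz N R μ w := by
  unfold pPot riesz
  rw [lintegral_lintegral_swap (measurable_pPot_kernel f).aemeasurable]
  have h1 : ∀ ρ : ℝ, ∫⁻ z, (∫⁻ w in pQt N ρ z, f w) / ENNReal.ofReal (ρ ^ (N + 1)) ∂μ =
      ∫⁻ w, f w * (μ (pQt N ρ w) / ENNReal.ofReal (ρ ^ (N + 1))) := by
    intro ρ
    have h := lintegral_lintegral_pQt_swap ρ volume μ hf
      (measurable_const (a := (ENNReal.ofReal (ρ ^ (N + 1)))⁻¹))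
    simp only [setLIntegral_const] at h
    simp only [div_eq_mul_inv]
    rw [lintegral_congr fun z => mul_comm _ _, h]
    exact lintegral_congr fun w => by rw [mul_comm (_⁻¹)]
  simp_rw [h1]
  rw [lintegral_lintegral_swap]
  · refine lintegral_congr fun w => ?_
    rw [lintegral_const_mul]
    have h : Measurable fun ρ : ℝ => ((w, ρ) : PSpace N × ℝ) := by fun_prop
    have h' := (measurable_measure_pQt_prod μ).comp h
    simp only [Function.comp_def] at h'
    exact h'.div (by fun_prop)
  · exact ((hf.comp measurable_snd).mul
      ((measurable_measure_pQt_uncurry μ).div (by fun_prop))).aemeasurable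

end Representation

section SobolevNorm

open scoped LineDeriv SchwartzMap

variable {N : ℕ}


theorem contDiff_coe (φ : SchwartzMap (PSpace N) ℝ) : ContDiff ℝ ∞ fun z => φ z := φ.smooth ⊤

theorem tDeriv_coe (φ : SchwartzMap (PSpace N) ℝ) :
    tDeriv (fun z => φ z) = fun z => (∂_{((0, 1) : PSpace N)} φ) z := by
  rw [tDeriv_eq_of_contDiff (contDiff_coe φ)]
  funext z
  exact (SchwartzMap.lineDerivOp_apply_eq_fderiv _ φ z).symm

theorem xDeriv_coe (φ : SchwartzMap (PSpace N) ℝ) (i : Fin N) :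
    xDeriv i (fun z => φ z) =
      fun z => (∂_{((EuclideanSpace.single i 1, 0) : PSpace N)} φ) z := by
  rw [xDeriv_eq_of_contDiff (contDiff_coe φ)]
  funext z
  exact (SchwartzMap.lineDerivOp_apply_eq_fderiv _ φ z).symm

theorem memLp_coe (φ : SchwartzMap (PSpace N) ℝ) (p : ℝ≥0∞) : MemLp (fun z => φ z) p volume :=
  φ.memLp p

theorem memLp_tDeriv (φ : SchwartzMap (PSpace N) ℝ) (p : ℝ≥0∞) :
    MemLp (tDeriv fun z => φ z) p volume := by
  rw [tDeriv_coe]; exact SchwartzMap.memLp _ p volume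

theorem memLp_xDeriv (φ : SchwartzMap (PSpace N) ℝ) (p : ℝ≥0∞) (i : Fin N) :
    MemLp (xDeriv i fun z => φ z) p volume := by
  rw [xDeriv_coe]; exact SchwartzMap.memLp _ p volume

theorem memLp_xxDeriv (φ : SchwartzMap (PSpace N) ℝ) (p : ℝ≥0∞) (i j : Fin N) :
    MemLp (xxDeriv i j fun z => φ z) p volume := by
  have h : xxDeriv i j (fun z => φ z) = xDeriv i (xDeriv j fun z => φ z) := rfl
  rw [h, xDeriv_coe]; exact memLp_xDeriv _ p i

/-- The spatial gradient as a vector field. -/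
noncomputable def xGrad (u : PSpace N → ℝ) (z : PSpace N) : EuclideanSpace ℝ (Fin N) :=
  WithLp.toLp 2 fun i => xDeriv i u z

theorem gradNorm_eq_norm_xGrad (u : PSpace N → ℝ) : gradNorm u = fun z => ‖xGrad u z‖ := by
  funext z
  simp [gradNorm, xGrad, EuclideanSpace.norm_eq]

theorem eLpNorm_gradNorm (u : PSpace N → ℝ) (p : ℝ≥0∞) :
    eLpNorm (gradNorm u) p volume = eLpNorm (xGrad u) p volume := by
  rw [gradNorm_eq_norm_xGrad, eLpNorm_norm]

theorem continuous_xGrad {u : PSpace N → ℝ} (hu : ContDiff ℝ ∞ u) : Continuous (xGrad u) := by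
  have h : Continuous fun z => fun i => xDeriv i u z :=
    continuous_pi fun i => (contDiff_xDeriv hu i).continuous
  exact (PiLp.continuous_toLp 2 fun _ : Fin N => ℝ).comp h

theorem norm_xGrad_le (u : PSpace N → ℝ) (z : PSpace N) :
    ‖xGrad u z‖ ≤ ∑ i, ‖xDeriv i u z‖ := by
  rw [← congrFun (gradNorm_eq_norm_xGrad u) z, gradNorm]
  refine Real.sqrt_le_iff.2 ⟨Finset.sum_nonneg fun _ _ => norm_nonneg _, ?_⟩
  simp_rw [← sq_abs (xDeriv _ u z), Real.norm_eq_abs]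
  exact Finset.sum_sq_le_sq_sum_of_nonneg fun _ _ => abs_nonneg _

theorem memLp_xGrad (φ : SchwartzMap (PSpace N) ℝ) (p : ℝ≥0∞) :
    MemLp (xGrad fun z => φ z) p volume := by
  have h : MemLp (fun z => ∑ i, ‖xDeriv i (fun z => φ z) z‖) p volume :=
    memLp_finsetSum Finset.univ fun i _ => (memLp_xDeriv φ p i).norm
  refine h.mono' (continuous_xGrad (contDiff_coe φ)).aestronglyMeasurable ?_
  exact Filter.Eventually.of_forall fun z => norm_xGrad_le _ z

theorem W21Norm_nonneg (p : ℝ) (u : PSpace N → ℝ) : 0 ≤ W21Norm N p u := by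
  unfold W21Norm; positivity

theorem W21Norm_add_le {p : ℝ} (hp : 1 ≤ p) (φ ψ : SchwartzMap (PSpace N) ℝ) :
    W21Norm N p (fun z => (φ + ψ) z) ≤ W21Norm N p (fun z => φ z) + W21Norm N p fun z => ψ z := by
  have hp' : 1 ≤ ENNReal.ofReal p := by simpa using hp
  have key : ∀ {E : Type} [NormedAddCommGroup E] {f g h : PSpace N → E},
      MemLp f (ENNReal.ofReal p) volume → MemLp g (ENNReal.ofReal p) volume → h = f + g →
      (eLpNorm h (ENNReal.ofReal p) volume).toReal ≤ (eLpNorm f (ENNReal.ofReal p) volume).toReal +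
        (eLpNorm g (ENNReal.ofReal p) volume).toReal := by
    intro E _ f g h hf hg e
    rw [e, ← ENNReal.toReal_add hf.eLpNorm_ne_top hg.eLpNorm_ne_top]
    exact ENNReal.toReal_mono (by finiteness [hf.eLpNorm_ne_top, hg.eLpNorm_ne_top]) (eLpNorm_add_le hf.1 hg.1 hp')
  have hu := contDiff_coe φ
  have hv := contDiff_coe ψ
  have h1 := key (h := fun z => (φ + ψ) z) (memLp_coe φ _) (memLp_coe ψ _) rfl
  have h2 := key (memLp_tDeriv φ _) (memLp_tDeriv ψ _) (tDeriv_add hu hv)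
  have h3 := key (h := xGrad fun z => (φ + ψ) z) (memLp_xGrad φ _) (memLp_xGrad ψ _) (by
    funext z
    ext i
    exact congrFun (xDeriv_add hu hv i) z)
  have h4 := fun i j => key (memLp_xxDeriv φ _ i j) (memLp_xxDeriv ψ _ i j) (xxDeriv_add hu hv i j)
  have h5 := Finset.sum_le_sum fun i (_ : i ∈ Finset.univ) =>
    Finset.sum_le_sum fun j (_ : j ∈ Finset.univ) => h4 i j
  simp only [Finset.sum_add_distrib] at h5
  simp only [W21Norm, eLpNorm_gradNorm]
  simp only [add_apply] at *
  linarith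

theorem W21Norm_smul {p : ℝ} (c : ℝ) (φ : SchwartzMap (PSpace N) ℝ) :
    W21Norm N p (fun z => (c • φ) z) = |c| * W21Norm N p (fun z => φ z) := by
  have hu := contDiff_coe φ
  have key : ∀ {E : Type} [NormedAddCommGroup E] [NormedSpace ℝ E] {f h : PSpace N → E},
      h = c • f → (eLpNorm h (ENNReal.ofReal p) volume).toReal =
        |c| * (eLpNorm f (ENNReal.ofReal p) volume).toReal := by
    intro E _ _ f h e
    rw [e, eLpNorm_const_smul, ENNReal.toReal_mul, toReal_enorm, Real.norm_eq_abs]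
  have h1 := key (h := fun z => (c • φ) z) (f := fun z => φ z) rfl
  have h2 := key (tDeriv_const_mul hu c)
  have h3 := key (h := xGrad fun z => (c • φ) z) (f := xGrad fun z => φ z) (by
    funext z
    ext i
    exact congrFun (xDeriv_const_mul hu c i) z)
  have h4 := fun i j => key (xxDeriv_const_mul hu c i j)
  simp only [W21Norm, eLpNorm_gradNorm]
  simp only [smul_apply, smul_eq_mul] at *
  simp only [h1, h2, h3, h4, mul_add, Finset.mul_sum]

/-- The oscillation gradient is controlled by the Sobolev norm. -/
theorem lintegral_pGrad_rpow_le {p : ℝ} (hp : 1 ≤ p) (φ : SchwartzMap (PSpace N) ℝ) :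
    (∫⁻ z, pGrad (fun z => φ z) z ^ p) ^ (1 / p) ≤ ENNReal.ofReal (W21Norm N p fun z => φ z) := by
  have hp0 : 0 < p := one_pos.trans_le hp
  have hp' : 1 ≤ ENNReal.ofReal p := by simpa using hp
  set P := ENNReal.ofReal p
  set F1 : PSpace N → ℝ := fun z => ‖φ z‖
  set F2 : PSpace N → ℝ := fun z => ‖tDeriv (fun z => φ z) z‖
  set F3 : Fin N → PSpace N → ℝ := fun i z => ‖xxDeriv i i (fun z => φ z) z‖
  have m1 : MemLp F1 P volume := (memLp_coe φ _).norm
  have m2 : MemLp F2 P volume := (memLp_tDeriv φ _).norm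
  have m3 : ∀ i, MemLp (F3 i) P volume := fun i => (memLp_xxDeriv φ _ i i).norm
  have e : ∀ z, pGrad (fun z => φ z) z = ‖(F1 + F2 + ∑ i, F3 i) z‖ₑ := by
    intro z
    rw [Real.enorm_of_nonneg]
    · simp only [Pi.add_apply, Finset.sum_apply, F1, F2, F3]
      rw [ENNReal.ofReal_add (by positivity) (by positivity),
        ENNReal.ofReal_add (by positivity) (by positivity),
        ENNReal.ofReal_sum_of_nonneg fun _ _ => by positivity]
      simp only [ofReal_norm, pGrad]
    · simp only [Pi.add_apply, Finset.sum_apply, F1, F2, F3]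
      positivity
  have h0 : (∫⁻ z, pGrad (fun z => φ z) z ^ p) ^ (1 / p) = eLpNorm (F1 + F2 + ∑ i, F3 i) P volume := by
    rw [eLpNorm_eq_lintegral_rpow_enorm_toReal (by simpa [P] using hp0) (by simp [P]),
      ENNReal.toReal_ofReal hp0.le]
    simp_rw [e]
  rw [h0]
  refine (eLpNorm_add_le (m1.1.add m2.1) (memLp_finsetSum' _ fun i _ => m3 i).1 hp').trans ?_
  refine (add_le_add_left (eLpNorm_add_le m1.1 m2.1 hp') _).trans ?_
  refine (add_le_add_right (eLpNorm_sum_le (fun i _ => (m3 i).1) hp') _).trans ?_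
  simp only [F1, F2, F3, eLpNorm_norm]
  have h3 : ∑ i, eLpNorm (xxDeriv i i fun z => φ z) P volume =
      ∑ i, ENNReal.ofReal (eLpNorm (xxDeriv i i fun z => φ z) P volume).toReal :=
    Finset.sum_congr rfl fun i _ =>
      (ENNReal.ofReal_toReal (memLp_xxDeriv φ P i i).eLpNorm_ne_top).symm
  rw [h3, ← ENNReal.ofReal_toReal (memLp_coe φ P).eLpNorm_ne_top,
    ← ENNReal.ofReal_toReal (memLp_tDeriv φ P).eLpNorm_ne_top,
    ← ENNReal.ofReal_add (by positivity) (by positivity),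
    ← ENNReal.ofReal_sum_of_nonneg fun _ _ => by positivity,
    ← ENNReal.ofReal_add (by positivity) (by positivity)]
  refine ENNReal.ofReal_le_ofReal ?_
  rw [W21Norm]
  have h5 : ∑ i, (eLpNorm (xxDeriv i i fun z => φ z) P volume).toReal ≤
      ∑ i, ∑ j, (eLpNorm (xxDeriv i j fun z => φ z) P volume).toReal :=
    Finset.sum_le_sum fun i _ => Finset.single_le_sum
      (f := fun j => (eLpNorm (xxDeriv i j fun z => φ z) P volume).toReal)
      (fun j _ => ENNReal.toReal_nonneg) (Finset.mem_univ i)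
  have h6 : 0 ≤ (eLpNorm (gradNorm fun z => φ z) P volume).toReal := ENNReal.toReal_nonneg
  linarith

/-- Measures with finite energy integrate Sobolev functions. -/
theorem exists_lintegral_enorm_le (N : ℕ) {R p q : ℝ} (hR : 0 < R) (hpq : p.HolderConjugate q) :
    ∃ C : ℝ≥0∞, C ≠ ⊤ ∧ ∀ (μ : Measure (PSpace N)) [SFinite μ] (φ : SchwartzMap (PSpace N) ℝ),
      ∫⁻ z, ‖φ z‖ₑ ∂μ ≤ C * (ENNReal.ofReal (W21Norm N p fun z => φ z) *
        (∫⁻ z, riesz N (2 * R) μ z ^ q) ^ (1 / q)) := by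
  obtain ⟨C, hC, h⟩ := exists_enorm_le_pPot N hR
  refine ⟨C, hC, fun μ _ φ => ?_⟩
  have hm := measurable_pGrad (contDiff_coe φ)
  calc ∫⁻ z, ‖φ z‖ₑ ∂μ ≤ ∫⁻ z, C * pPot (pGrad fun z => φ z) (2 * R) z ∂μ :=
        lintegral_mono fun z => h _ (contDiff_coe φ) z
    _ = C * ∫⁻ w, pGrad (fun z => φ z) w * riesz N (2 * R) μ w := by
        rw [lintegral_const_mul' _ _ hC, lintegral_pPot _ _ hm]
    _ ≤ _ := by
        refine mul_le_mul_right ?_ _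
        refine (ENNReal.lintegral_mul_le_Lp_mul_Lq volume hpq hm.aemeasurable
          (measurable_riesz _ μ).aemeasurable).trans ?_
        exact mul_le_mul_left (lintegral_pGrad_rpow_le hpq.lt.le φ) _

end SobolevNorm

section Duality

open CompactlySupported

variable {N : ℕ} {p : ℝ} {K : Set (PSpace N)}


theorem exists_schwartzMap_eq_one (hK : IsCompact K) :
    ∃ φ : SchwartzMap (PSpace N) ℝ, (∀ z, 0 ≤ φ z) ∧ ∃ U, IsOpen U ∧ K ⊆ U ∧ ∀ z ∈ U, φ z = 1 := by
  obtain ⟨r, hr⟩ := hK.isBounded.subset_ball 0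
  set s := max r 1
  have hs : 1 ≤ s := le_max_right _ _
  obtain ⟨M, -, h⟩ := exists_cutoff N s
  obtain ⟨g, hg, hgc, hg0, hg1, -⟩ := h s (by positivity) le_rfl
  refine ⟨hgc.toSchwartzMap hg, hg0, pQt N s 0, isOpen_pQt N s 0, fun z hz => ?_, hg1⟩
  have hz' := hr hz
  rw [mem_ball, Prod.dist_eq, max_lt_iff, Real.dist_eq] at hz'
  have hrs : r ≤ s := le_max_left _ _
  exact mem_pQt.2 ⟨hz'.1.trans_le hrs, (hz'.2.trans_le hrs).trans_le (by nlinarith)⟩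

theorem cap21c_nonneg (N : ℕ) (p : ℝ) (K : Set (PSpace N)) : 0 ≤ cap21c N p K := by
  refine Real.sInf_nonneg ?_
  rintro c ⟨φ, -, rfl⟩
  exact Real.rpow_nonneg (W21Norm_nonneg p _) p

theorem cap21c_le (φ : SchwartzMap (PSpace N) ℝ) {U : Set (PSpace N)} (hU : IsOpen U) (hKU : K ⊆ U)
    (h : ∀ z ∈ U, 1 ≤ φ z) : cap21c N p K ≤ W21Norm N p (fun z => φ z) ^ p := by
  refine csInf_le ⟨0, ?_⟩ ⟨φ, ⟨U, hU, hKU, h⟩, rfl⟩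
  rintro c ⟨φ, -, rfl⟩
  exact Real.rpow_nonneg (W21Norm_nonneg p _) p

theorem cap21c_rpow_le (hp : 0 < p) {φ : SchwartzMap (PSpace N) ℝ} (h : ∀ z ∈ K, 1 ≤ φ z) :
    cap21c N p K ^ (1 / p) ≤ W21Norm N p fun z => φ z := by
  set W := W21Norm N p fun z => φ z
  have hW : 0 ≤ W := W21Norm_nonneg p _
  have key : ∀ ε : ℝ, 0 < ε → cap21c N p K ^ (1 / p) ≤ (1 + ε) * W := by
    intro ε hε
    have h1 : cap21c N p K ≤ W21Norm N p (fun z => ((1 + ε) • φ) z) ^ p := by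
      refine cap21c_le ((1 + ε) • φ) (U := {z | 1 < (1 + ε) * φ z})
        (isOpen_lt continuous_const (continuous_const.mul φ.continuous)) (fun z hz => ?_)
        fun z hz => le_of_lt hz
      have := h z hz
      change 1 < (1 + ε) * φ z
      nlinarith
    rw [W21Norm_smul, abs_of_pos (by positivity)] at h1
    calc _ ≤ (((1 + ε) * W) ^ p) ^ (1 / p) :=
          Real.rpow_le_rpow (cap21c_nonneg N p K) h1 (by positivity)
      _ = _ := by
          rw [← Real.rpow_mul (by positivity), mul_one_div_cancel hp.ne', Real.rpow_one]
  refine le_of_forall_pos_le_add fun δ hδ => (key (δ / (W + 1)) (by positivity)).trans ?_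
  have : δ / (W + 1) * W ≤ δ := by
    rw [div_mul_eq_mul_div, div_le_iff₀ (by positivity)]
    nlinarith
  linarith

/-- The Sobolev gauge of a continuous function on a set. -/
noncomputable def pGauge (p : ℝ) (K : Set (PSpace N)) (f : K → ℝ) : ℝ :=
  sInf { c | ∃ φ : SchwartzMap (PSpace N) ℝ, (∀ z : K, f z ≤ φ z) ∧ c = W21Norm N p fun z => φ z }

theorem pGauge_le {f : K → ℝ} (φ : SchwartzMap (PSpace N) ℝ) (h : ∀ z : K, f z ≤ φ z) :
    pGauge p K f ≤ W21Norm N p fun z => φ z := by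
  refine csInf_le ⟨0, ?_⟩ ⟨φ, h, rfl⟩
  rintro c ⟨φ, -, rfl⟩
  exact W21Norm_nonneg p _

theorem le_pGauge (hK : IsCompact K) {f : K → ℝ} (hf : BddAbove (range f)) {c : ℝ}
    (h : ∀ φ : SchwartzMap (PSpace N) ℝ, (∀ z : K, f z ≤ φ z) → c ≤ W21Norm N p fun z => φ z) :
    c ≤ pGauge p K f := by
  refine le_csInf ?_ ?_
  · obtain ⟨M, hM⟩ := hf
    obtain ⟨φ, -, U, -, hKU, hφ⟩ := exists_schwartzMap_eq_one hK
    refine ⟨_, M • φ, fun z => ?_, rfl⟩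
    rw [smul_apply, hφ z (hKU z.2), smul_eq_mul, mul_one]
    exact hM (mem_range_self z)
  · rintro _ ⟨φ, hφ, rfl⟩
    exact h φ hφ

theorem pGauge_nonneg (f : K → ℝ) : 0 ≤ pGauge p K f := by
  refine Real.sInf_nonneg ?_
  rintro c ⟨φ, -, rfl⟩
  exact W21Norm_nonneg p _

theorem pGauge_smul (hK : IsCompact K) {f : K → ℝ} (hf : BddAbove (range f)) {c : ℝ} (hc : 0 < c) :
    pGauge p K (fun z => c * f z) = c * pGauge p K f := by
  have key : ∀ (c : ℝ) (g : K → ℝ), BddAbove (range g) → 0 < c →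
      pGauge p K (fun z => c * g z) ≤ c * pGauge p K g := by
    intro c g hg hc
    rw [← div_le_iff₀' hc]
    refine le_pGauge hK hg fun φ hφ => ?_
    rw [div_le_iff₀' hc]
    have := W21Norm_smul (p := p) c φ
    rw [abs_of_pos hc] at this
    rw [← this]
    exact pGauge_le (c • φ) fun z => mul_le_mul_of_nonneg_left (hφ z) hc.le
  refine le_antisymm (key c f hf hc) ?_
  have hg : BddAbove (range fun z => c * f z) := by
    obtain ⟨M, hM⟩ := hf
    refine ⟨c * M, ?_⟩
    rintro _ ⟨z, rfl⟩
    exact mul_le_mul_of_nonneg_left (hM (mem_range_self z)) hc.le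
  have h := key c⁻¹ _ hg (inv_pos.2 hc)
  simp only [inv_mul_cancel_left₀ hc.ne'] at h
  rwa [le_inv_mul_iff₀ hc] at h

theorem pGauge_add_le (hp : 1 ≤ p) (hK : IsCompact K) {f g : K → ℝ} (hf : BddAbove (range f))
    (hg : BddAbove (range g)) :
    pGauge p K (fun z => f z + g z) ≤ pGauge p K f + pGauge p K g := by
  rw [← sub_le_iff_le_add]
  refine le_pGauge hK hf fun φ hφ => ?_
  rw [sub_le_comm]
  refine le_pGauge hK hg fun ψ hψ => ?_
  rw [sub_le_iff_le_add']
  exact (pGauge_le (φ + ψ) fun z => add_le_add (hφ z) (hψ z)).trans (W21Norm_add_le hp φ ψ)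

/-- A dual extremal measure for the capacity. -/
theorem exists_measure_integral_le_W21Norm (hp : 1 ≤ p) (hK : IsCompact K) (hne : K.Nonempty) :
    ∃ μ : Measure (PSpace N), IsFiniteMeasure μ ∧ μ Kᶜ = 0 ∧
      μ K = ENNReal.ofReal (cap21c N p K ^ (1 / p)) ∧
      ∀ φ : SchwartzMap (PSpace N) ℝ, ∫ z, φ z ∂μ ≤ W21Norm N p fun z => φ z := by
  have hp0 : 0 < p := one_pos.trans_le hp
  have : CompactSpace K := isCompact_iff_compactSpace.1 hK
  have : Nonempty K := hne.to_subtype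
  set c := cap21c N p K ^ (1 / p) with hc
  have hc0 : 0 ≤ c := Real.rpow_nonneg (cap21c_nonneg N p K) _
  have hbdd : ∀ f : C_c(K, ℝ), BddAbove (range f) := fun f =>
    (isCompact_range f.continuous).bddAbove
  let one : C_c(K, ℝ) := ⟨ContinuousMap.const K 1, HasCompactSupport.of_compactSpace _⟩
  have hone : ∀ z, one z = 1 := fun _ => rfl
  have hone0 : one ≠ 0 := fun h => by
    obtain ⟨z⟩ := ‹Nonempty K›
    simpa [hone] using DFunLike.congr_fun h z
  have hP1 : c ≤ pGauge p K one :=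
    le_pGauge hK (hbdd one) fun φ hφ => cap21c_rpow_le hp0 fun z hz => hφ ⟨z, hz⟩
  have hhom : ∀ t : ℝ, 0 < t → ∀ f : C_c(K, ℝ), pGauge p K (t • f : C_c(K, ℝ)) = t * pGauge p K f :=
    fun t ht f => pGauge_smul hK (hbdd f) ht
  obtain ⟨g, hg1, hg⟩ := exists_extension_of_le_sublinear (LinearPMap.mkSpanSingleton one c hone0)
    (fun f => pGauge p K f) hhom (fun f g => pGauge_add_le hp hK (hbdd f) (hbdd g)) (by
      rintro ⟨x, hx⟩
      obtain ⟨t, rfl⟩ := Submodule.mem_span_singleton.1 hx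
      rw [LinearPMap.mkSpanSingleton'_apply]
      change t * c ≤ pGauge p K (t • one : C_c(K, ℝ))
      rcases le_or_gt t 0 with ht | ht
      · exact (mul_nonpos_of_nonpos_of_nonneg ht hc0).trans (pGauge_nonneg _)
      · rw [hhom t ht]
        exact mul_le_mul_of_nonneg_left hP1 ht.le)
  have hgone : g one = c :=
    (hg1 ⟨one, Submodule.mem_span_singleton_self one⟩).trans
      (LinearPMap.mkSpanSingleton'_apply_self _ _ _ _)
  have hpos : ∀ f : C_c(K, ℝ), 0 ≤ f → 0 ≤ g f := by
    intro f hf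
    have h1 : pGauge p K (-f : C_c(K, ℝ)) ≤ W21Norm N p fun z => (((0 : ℝ) • (0 : SchwartzMap (PSpace N) ℝ)) z) :=
      pGauge_le _ fun z => by
        have : 0 ≤ f z := hf z
        simpa using this
    rw [W21Norm_smul, abs_zero, zero_mul] at h1
    have h2 := (hg (-f)).trans h1
    rw [map_neg] at h2
    linarith
  let Λ : C_c(K, ℝ) →ₚ[ℝ] ℝ := PositiveLinearMap.mk₀ g hpos
  let ν := RealRMK.rieszMeasure Λ
  have hν : ∀ f : C_c(K, ℝ), ∫ z, f z ∂ν = g f := fun f => RealRMK.integral_rieszMeasure Λ f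
  have : IsFiniteMeasure ν := by infer_instance
  have hνu : ν univ = ENNReal.ofReal c := by
    have h := hν one
    simp only [hone, hgone, integral_const, smul_eq_mul, mul_one] at h
    rw [← h, measureReal_def, ENNReal.ofReal_toReal (measure_ne_top _ _)]
  have hKm : MeasurableSet K := hK.measurableSet
  refine ⟨ν.map Subtype.val, inferInstance, ?_, ?_, fun φ => ?_⟩
  · rw [Measure.map_apply measurable_subtype_coe hKm.compl]
    simp
  · rw [Measure.map_apply measurable_subtype_coe hKm]
    simpa using hνu
  · rw [integral_map measurable_subtype_coe.aemeasurable φ.continuous.aestronglyMeasurable]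
    let f : C_c(K, ℝ) := ⟨⟨fun z => φ z, φ.continuous.comp continuous_subtype_val⟩,
      HasCompactSupport.of_compactSpace _⟩
    have h := hν f
    change ∫ z : K, φ z ∂ν = g f at h
    rw [h]
    exact (hg f).trans (pGauge_le φ fun z => le_rfl)

end Duality

section Capacity

variable {N : ℕ} {p q : ℝ} {K : Set (PSpace N)}

/-- The Riesz potential is dominated by a dyadic sum of densities. -/
theorem riesz_le_tsum_pDens {r : ℝ} (hr : 0 < r) (μ : Measure (PSpace N)) (z : PSpace N) :
    riesz N r μ z ≤ 2 ^ N * ∑' k : ℕ, pDens μ (r / 2 ^ k) z := by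
  have hcover : Ioo 0 r ⊆ ⋃ k : ℕ, Ioc (r / 2 ^ (k + 1)) (r / 2 ^ k) := by
    intro ρ hρ
    obtain ⟨n, h1, h2⟩ := exists_nat_pow_near_of_lt_one (x := ρ / r) (y := 1 / 2)
      (div_pos hρ.1 hr) ((div_le_one hr).2 hρ.2.le) (by norm_num) (by norm_num)
    rw [lt_div_iff₀ hr, one_div_pow, one_div_mul_eq_div] at h1
    rw [div_le_iff₀ hr, one_div_pow, one_div_mul_eq_div] at h2
    exact mem_iUnion.2 ⟨n, h1, h2⟩
  rw [riesz, ← ENNReal.tsum_mul_left]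
  refine (lintegral_mono_set hcover).trans ((lintegral_iUnion_le _ _).trans
    (ENNReal.tsum_le_tsum fun k => ?_))
  set s := r / 2 ^ (k + 1) with hs
  have hs0 : 0 < s := by positivity
  have hrs : r / 2 ^ k = 2 * s := by rw [hs, pow_succ]; field_simp
  rw [hrs]
  calc _ ≤ ∫⁻ _ρ in Ioc s (2 * s), μ (pQt N (2 * s) z) / ENNReal.ofReal (s ^ (N + 1)) := by
        refine setLIntegral_mono' measurableSet_Ioc fun ρ hρ => ?_
        have h1 : pQt N ρ z ⊆ pQt N (2 * s) z := pQt_mono (hs0.trans hρ.1).le hρ.2 z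
        have h2 : s ≤ ρ := hρ.1.le
        gcongr
    _ = 2 ^ N * pDens μ (2 * s) z := by
        have h2 : (2 : ℝ≥0∞) ^ N * (2 ^ N)⁻¹ = 1 :=
          ENNReal.mul_inv_cancel (by positivity) (by finiteness)
        have h3 : (ENNReal.ofReal s)⁻¹ * ENNReal.ofReal s = 1 :=
          ENNReal.inv_mul_cancel (by simpa using hs0) (by simp)
        rw [setLIntegral_const, Real.volume_Ioc, two_mul s, add_sub_cancel_right, ← two_mul s,
          pDens, mul_pow, ENNReal.ofReal_mul (p := 2 ^ N) (by positivity), pow_succ,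
          ENNReal.ofReal_mul (p := s ^ N) (by positivity),
          ENNReal.mul_inv (by simp) (by simp),
          ENNReal.ofReal_pow (p := 2) (by norm_num), ENNReal.ofReal_ofNat, div_eq_mul_inv,
          ENNReal.mul_inv (by simp [hs0]) (by simp)]
        calc _ = μ (pQt N (2 * s) z) * (ENNReal.ofReal (s ^ N))⁻¹ *
              ((ENNReal.ofReal s)⁻¹ * ENNReal.ofReal s) := by ring
          _ = (2 ^ N * (2 ^ N)⁻¹) * (ENNReal.ofReal (s ^ N))⁻¹ * μ (pQt N (2 * s) z) := by
            rw [h2, h3]; ring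
          _ = _ := by ring

theorem cap21c_empty (hp : 0 < p) : cap21c N p (∅ : Set (PSpace N)) = 0 := by
  refine le_antisymm ?_ (cap21c_nonneg N p ∅)
  have h := cap21c_le (K := ∅) (p := p) ((0 : ℝ) • (0 : SchwartzMap (PSpace N) ℝ)) isOpen_empty
    (empty_subset _) (by simp)
  rwa [W21Norm_smul, abs_zero, zero_mul, Real.zero_rpow hp.ne'] at h

/-- A measure on `K` of mass equal to the capacity, with the extremal duality bound. -/
theorem exists_measure_eq_cap21c (hpq : p.HolderConjugate q) (hK : IsCompact K) :
    ∃ μ : Measure (PSpace N), IsFiniteMeasure μ ∧ μ Kᶜ = 0 ∧ μ K = ENNReal.ofReal (cap21c N p K) ∧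
      ∃ A : ℝ≥0∞, A ^ q = ENNReal.ofReal (cap21c N p K) ∧ ∀ φ : SchwartzMap (PSpace N) ℝ,
        ENNReal.ofReal (∫ z, φ z ∂μ) ≤ A * ENNReal.ofReal (W21Norm N p fun z => φ z) := by
  rcases K.eq_empty_or_nonempty with rfl | hne
  · refine ⟨0, inferInstance, by simp, by simp [cap21c_empty hpq.pos], 0, ?_, by simp⟩
    rw [cap21c_empty hpq.pos, ENNReal.zero_rpow_of_pos hpq.symm.pos, ENNReal.ofReal_zero]
  obtain ⟨μ, hμ, hμK, hμc, h⟩ := exists_measure_integral_le_W21Norm hpq.lt.le hK hne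
  set x := cap21c N p K
  have hx : 0 ≤ x := cap21c_nonneg N p K
  have hp1 : 0 < p - 1 := sub_pos.2 hpq.lt
  have hy : 0 ≤ x ^ (1 / p) := by positivity
  have hyp : (x ^ (1 / p)) ^ p = x := by
    rw [← Real.rpow_mul hx, one_div_mul_cancel hpq.pos.ne', Real.rpow_one]
  set y := x ^ (1 / p)
  have hB : 0 ≤ y ^ (p - 1) := by positivity
  refine ⟨ENNReal.ofReal (y ^ (p - 1)) • μ, Measure.smul_finite _ (by simp), by simp [hμK], ?_,
    ENNReal.ofReal (y ^ (p - 1)), ?_, fun φ => ?_⟩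
  · rw [Measure.smul_apply, smul_eq_mul, hμc, ← ENNReal.ofReal_mul hB]
    congr 1
    rcases hy.eq_or_lt with h0 | h0
    · rw [← h0, mul_zero]
      rw [← h0, Real.zero_rpow hpq.pos.ne'] at hyp
      exact hyp
    · rw [← Real.rpow_add_one h0.ne', sub_add_cancel, hyp]
  · rw [ENNReal.ofReal_rpow_of_nonneg hB hpq.symm.pos.le, ← Real.rpow_mul hy,
      hpq.sub_one_mul_conj, hyp]
  · rw [integral_smul_measure, ENNReal.toReal_ofReal hB, smul_eq_mul, ← ENNReal.ofReal_mul hB]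
    exact ENNReal.ofReal_le_ofReal (mul_le_mul_of_nonneg_left (h φ) hB)

theorem cap21c_le_mul_rpow (hp : 0 < p) (hK : IsCompact K) {x B : ℝ} (hx : 0 ≤ x) (hB : 0 ≤ B)
    (h : ∀ φ : SchwartzMap (PSpace N) ℝ, (∀ z ∈ K, 1 ≤ φ z) → x ≤ B * W21Norm N p fun z => φ z) :
    x ≤ B * cap21c N p K ^ (1 / p) := by
  obtain ⟨φ₀, -, U₀, hU₀, hKU₀, hφ₀⟩ := exists_schwartzMap_eq_one hK
  rcases hB.eq_or_lt with rfl | hB'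
  · simpa using h φ₀ fun z hz => (hφ₀ z (hKU₀ hz)).ge
  rw [← div_le_iff₀' hB']
  have hxB : 0 ≤ x / B := by positivity
  have h1 : (x / B) ^ p ≤ cap21c N p K := by
    refine le_csInf ⟨_, φ₀, ⟨U₀, hU₀, hKU₀, fun z hz => (hφ₀ z hz).ge⟩, rfl⟩ ?_
    rintro _ ⟨φ, ⟨U, -, hKU, hφ⟩, rfl⟩
    refine Real.rpow_le_rpow hxB ?_ hp.le
    rw [div_le_iff₀' hB']
    exact h φ fun z hz => hφ z (hKU hz)
  calc x / B = ((x / B) ^ p) ^ (1 / p) := by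
        rw [← Real.rpow_mul hxB, mul_one_div_cancel hp.ne', Real.rpow_one]
    _ ≤ _ := Real.rpow_le_rpow (by positivity) h1 (by positivity)

theorem exists_lintegral_riesz_rpow_le (N : ℕ) {r : ℝ} (hr : 0 < r) (hpq : p.HolderConjugate q) :
    ∃ C : ℝ≥0∞, C ≠ ⊤ ∧ ∀ (μ : Measure (PSpace N)) [IsFiniteMeasure μ] (K : Set (PSpace N)),
      IsCompact K → μ Kᶜ = 0 → ∀ A : ℝ≥0∞, (∀ φ : SchwartzMap (PSpace N) ℝ,
        ENNReal.ofReal (∫ z, φ z ∂μ) ≤ A * ENNReal.ofReal (W21Norm N p fun z => φ z)) →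
      ∫⁻ z, riesz N r μ z ^ q ≤ C * A ^ q := by
  have hq : 0 ≤ q := hpq.symm.pos.le
  obtain ⟨C, hC, h⟩ := exists_lintegral_tsum_pDens_le N hr hpq
  refine ⟨(2 ^ N) ^ q * C, ENNReal.mul_ne_top
    (ENNReal.rpow_ne_top_of_nonneg hq (by finiteness)) hC, fun μ _ K hK hμ A hA => ?_⟩
  calc ∫⁻ z, riesz N r μ z ^ q ≤
        ∫⁻ z, (2 ^ N) ^ q * (∑' k : ℕ, pDens μ (r / 2 ^ k) z) ^ q := by
        refine lintegral_mono fun z => ?_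
        rw [← ENNReal.mul_rpow_of_nonneg _ _ hq]
        exact ENNReal.rpow_le_rpow (riesz_le_tsum_pDens hr μ z) hq
    _ = (2 ^ N) ^ q * ∫⁻ z, (∑' k : ℕ, pDens μ (r / 2 ^ k) z) ^ q :=
        lintegral_const_mul' _ _ (ENNReal.rpow_ne_top_of_nonneg hq (by finiteness))
    _ ≤ _ := by
        rw [mul_assoc]
        exact mul_le_mul_right (h μ K hK hμ A hA) _

/-- A measure on `K` with mass at least the capacity has energy at least the capacity. -/
theorem exists_cap21c_le_lintegral_riesz_rpow (N : ℕ) {R : ℝ} (hR : 0 < R)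
    (hpq : p.HolderConjugate q) :
    ∃ C : ℝ≥0∞, C ≠ ⊤ ∧ ∀ (μ : Measure (PSpace N)) [IsFiniteMeasure μ] (K : Set (PSpace N)),
      IsCompact K → μ K = ENNReal.ofReal (cap21c N p K) →
      ENNReal.ofReal (cap21c N p K) ≤ C * ∫⁻ z, riesz N (2 * R) μ z ^ q := by
  have hq : 0 < q := hpq.symm.pos
  obtain ⟨C, hC, h⟩ := exists_lintegral_enorm_le N hR hpq
  refine ⟨C ^ q + 1, by finiteness, fun μ _ K hK hμ => ?_⟩
  set I := ∫⁻ z, riesz N (2 * R) μ z ^ q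
  set x := cap21c N p K
  have hx : 0 ≤ x := cap21c_nonneg N p K
  rcases eq_or_ne I ⊤ with hI | hI
  · simp [hI]
  have hBt : C * I ^ (1 / q) ≠ ⊤ :=
    ENNReal.mul_ne_top hC (ENNReal.rpow_ne_top_of_nonneg (by positivity) hI)
  have key : x ≤ (C * I ^ (1 / q)).toReal * x ^ (1 / p) := by
    refine cap21c_le_mul_rpow hpq.pos hK hx ENNReal.toReal_nonneg fun φ hφ => ?_
    rw [← ENNReal.ofReal_le_ofReal_iff (mul_nonneg ENNReal.toReal_nonneg (W21Norm_nonneg p _)),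
      ENNReal.ofReal_mul ENNReal.toReal_nonneg, ENNReal.ofReal_toReal hBt, ← hμ]
    calc μ K = ∫⁻ _z in K, 1 ∂μ := by simp
      _ ≤ ∫⁻ z in K, ‖φ z‖ₑ ∂μ := by
          refine setLIntegral_mono' hK.measurableSet fun z hz => ?_
          rw [Real.enorm_eq_ofReal_abs, ENNReal.one_le_ofReal]
          exact (hφ z hz).trans (le_abs_self _)
      _ ≤ ∫⁻ z, ‖φ z‖ₑ ∂μ := setLIntegral_le_lintegral _ _
      _ ≤ _ := h μ φ
      _ = _ := by ring
  have key' : ENNReal.ofReal x ≤ C * I ^ (1 / q) * ENNReal.ofReal x ^ (1 / p) := by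
    rw [ENNReal.ofReal_rpow_of_nonneg hx (by have := hpq.pos; positivity),
      ← ENNReal.ofReal_toReal hBt, ← ENNReal.ofReal_mul ENNReal.toReal_nonneg]
    exact ENNReal.ofReal_le_ofReal key
  have h1 := ENNReal.le_rpow_of_le_mul_rpow hpq (by simp) key'
  rw [ENNReal.mul_rpow_of_nonneg _ _ hq.le, ← ENNReal.rpow_mul, one_div_mul_cancel hq.ne',
    ENNReal.rpow_one] at h1
  exact h1.trans (mul_le_mul_left le_self_add _)

end Capacity

end CapacitaryMeasure

/-- **Theorem 2.2.** Existence of a capacitary measure: for every compact `K` there is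
a nonnegative Radon measure `μ` supported in `K` with
`μ(K) ≍ Cap_{2,1,q'}(K) ≍ ∫ (I_2^{2R}[μ])^q`. -/
theorem capacitary_measure_exists
    (N : ℕ) (hN : 2 ≤ N) (q : ℝ) (hq : 1 < q) (R : ℝ) (hR : 0 < R) :
    ∃ C : ℝ, 1 ≤ C ∧ ∀ K : Set (PSpace N), IsCompact K →
      ∃ μ : Measure (PSpace N), IsFiniteMeasure μ ∧ μ Kᶜ = 0 ∧
        ENNReal.ofReal (C⁻¹ * cap21c N (q / (q - 1)) K) ≤ μ K ∧
        μ K ≤ ENNReal.ofReal (C * cap21c N (q / (q - 1)) K) ∧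
        ENNReal.ofReal (C⁻¹ * cap21c N (q / (q - 1)) K) ≤
          (∫⁻ z, riesz N (2 * R) μ z ^ q) ∧
        (∫⁻ z, riesz N (2 * R) μ z ^ q) ≤ ENNReal.ofReal (C * cap21c N (q / (q - 1)) K) := by
  have hpq : (q / (q - 1)).HolderConjugate q := (Real.HolderConjugate.conjExponent hq).symm
  set p := q / (q - 1)
  obtain ⟨C₁, hC₁, h₁⟩ := exists_lintegral_riesz_rpow_le N (r := 2 * R) (by positivity) hpq
  obtain ⟨C₂, hC₂, h₂⟩ := exists_cap21c_le_lintegral_riesz_rpow N hR hpq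
  set C := max 1 (max C₁.toReal C₂.toReal) with hC
  have hC1 : 1 ≤ C := le_max_left _ _
  have hC0 : 0 < C := one_pos.trans_le hC1
  have le_C : ∀ {D : ℝ≥0∞}, D ≠ ⊤ → D.toReal ≤ C → D ≤ ENNReal.ofReal C := fun hD h => by
    rw [← ENNReal.ofReal_toReal hD]; exact ENNReal.ofReal_le_ofReal h
  refine ⟨C, hC1, fun K hK => ?_⟩
  obtain ⟨μ, hμ, hμK, hμc, A, hA, h⟩ := exists_measure_eq_cap21c hpq hK
  have hx : 0 ≤ cap21c N p K := cap21c_nonneg N p K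
  refine ⟨μ, hμ, hμK, ?_, ?_, ?_, ?_⟩
  · rw [hμc]
    exact ENNReal.ofReal_le_ofReal (mul_le_of_le_one_left hx (inv_le_one_of_one_le₀ hC1))
  · rw [hμc]
    exact ENNReal.ofReal_le_ofReal (le_mul_of_one_le_left hx hC1)
  · rw [ENNReal.ofReal_mul (by positivity), ENNReal.ofReal_inv_of_pos hC0,
      ENNReal.inv_mul_le_iff (by simpa using hC0) (by simp)]
    refine (h₂ μ K hK hμc).trans (mul_le_mul_left (le_C hC₂ ?_) _)
    exact (le_max_right _ _).trans (le_max_right _ _)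
  · rw [ENNReal.ofReal_mul hC0.le, ← hA]
    refine (h₁ μ K hK hμK A h).trans (mul_le_mul_left (le_C hC₁ ?_) _)
    exact (le_max_left _ _).trans (le_max_right _ _)
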